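/- Let n ≥ 21, let s be an integer with 2 ≤ s ≤ 2^(n−1), and let 0 ≤ i ≤ C(n,2). Suppose 𝓐 = [n]^(≥3) ∪ 𝓑 with 𝓑 ⊆ [n]^(2) and |𝓐| = (∑_{k=3}^n C(n,k)) + i (so |𝓑| = i), and suppose that among all families of this form and this size, 𝓐 maximises |𝕀^(s)(𝓐)|. Then 𝓑 maximises the number of intersecting pairs — i.e. the number of unordered pairs {B, B'} ⊆ 𝓑 with B ≠ B' and B ∩ B' ≠ ∅ — over all subfamilies of [n]^(2) of size i. -/

import Mathlib

open Finset

/-- The ground set `[n] = {1, …, n}`. -/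
def groundSet (n : ℕ) : Finset ℕ := Finset.Icc 1 n

/-- All subsets of `[n]`. -/
def allFams (n : ℕ) : Finset (Finset ℕ) := (groundSet n).powerset

/-- `[n]^(≥ r)`: subsets of `[n]` of size at least `r`. -/
def layerGE (n r : ℕ) : Finset (Finset ℕ) := (allFams n).filter fun A => r ≤ A.card

/-- `[n]^(r)`: subsets of `[n]` of size exactly `r`. -/
def layerEQ (n r : ℕ) : Finset (Finset ℕ) := (groundSet n).powersetCard r

/-- `𝕀^(s)(𝓐)`: the intersecting subfamilies of `𝓐` of size `s`. -/
def interFams (s : ℕ) (𝓐 : Finset (Finset ℕ)) : Finset (Finset (Finset ℕ)) :=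
  (𝓐.powersetCard s).filter fun 𝓔 => ∀ B ∈ 𝓔, ∀ B' ∈ 𝓔, (B ∩ B').Nonempty

/-- The number of intersecting pairs in `𝓑`: unordered pairs `{B, B'} ⊆ 𝓑` with
`B ≠ B'` and `B ∩ B' ≠ ∅`. -/
def interPairs (𝓑 : Finset (Finset ℕ)) : ℕ :=
  ((𝓑.powersetCard 2).filter fun P => ∀ B ∈ P, ∀ B' ∈ P, (B ∩ B').Nonempty).card

/-- The subsets of size at least two of the sets `insert v S`, `S ∈ 𝒮`. -/
def shadowSets (v : ℕ) (𝒮 : Finset (Finset ℕ)) : Finset (Finset ℕ) :=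
  𝒮.biUnion fun S => (insert v S).powerset.filter fun T => 2 ≤ #T

/-- The binomial coefficient `C(N, m - t)`, read as `0` when `m < t`. -/
def chooseSub (N m t : ℕ) : ℕ := if t ≤ m then N.choose (m - t) else 0

/-- The weighted number of subfamilies of `𝒬`. -/
def shadowSum (v : ℕ) (𝒬 : Finset (Finset ℕ)) (N m : ℕ) : ℕ :=
  ∑ 𝒮 ∈ 𝒬.powerset, chooseSub (N - #(shadowSets v 𝒮)) m #𝒮

theorem chooseSub_mono {N N' : ℕ} (h : N ≤ N') (m t : ℕ) : chooseSub N m t ≤ chooseSub N' m t := by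
  unfold chooseSub
  split_ifs
  · exact Nat.choose_le_choose _ h
  · rfl

theorem shadowSets_insert_empty (v : ℕ) (𝒮 : Finset (Finset ℕ)) :
    shadowSets v (insert ∅ 𝒮) = shadowSets v 𝒮 := by
  unfold shadowSets
  rw [biUnion_insert]
  have : ((insert v (∅ : Finset ℕ)).powerset.filter fun T => 2 ≤ #T) = ∅ := by
    refine filter_eq_empty_iff.2 fun T hT h => ?_
    have := card_le_card (mem_powerset.1 hT)
    simp at this
    omega
  rw [this, empty_union]

theorem shadowSum_insert_empty (v : ℕ) (𝒬 : Finset (Finset ℕ)) (h𝒬 : ∅ ∉ 𝒬) (N m : ℕ) :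
    shadowSum v 𝒬 (N + 1) (m + 1) ≤ shadowSum v (insert ∅ 𝒬) N (m + 1) := by
  unfold shadowSum
  rw [sum_powerset_insert h𝒬, ← sum_add_distrib]
  refine sum_le_sum fun 𝒮 h𝒮 => ?_
  have hn : ∅ ∉ 𝒮 := fun h => h𝒬 (mem_powerset.1 h𝒮 h)
  rw [shadowSets_insert_empty, card_insert_of_notMem hn]
  refine (chooseSub_mono (N' := N - #(shadowSets v 𝒮) + 1) (by omega) _ _).trans ?_
  generalize N - #(shadowSets v 𝒮) = M
  generalize #𝒮 = t
  unfold chooseSub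
  rcases lt_trichotomy t (m + 1) with h | h | h
  · rw [if_pos h.le, if_pos h.le, if_pos (by omega), show m + 1 - t = (m - t) + 1 by omega,
      show m + 1 - (t + 1) = m - t by omega, Nat.choose_succ_succ']
    omega
  · subst h; simp
  · rw [if_neg (by omega)]; omega

theorem sum_le_shadowSum {ι : Type*} [DecidableEq ι] (v : ℕ) (𝒬 : Finset (Finset ℕ)) (N m : ℕ)
    (I : Finset ι) (g : ι → Finset (Finset ℕ)) (hg : Set.InjOn g I) (hI : ∀ i ∈ I, g i ⊆ 𝒬) :
    ∑ i ∈ I, chooseSub (N - #(shadowSets v (g i))) m #(g i) ≤ shadowSum v 𝒬 N m := by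
  rw [← sum_image (f := fun 𝒮 => chooseSub (N - #(shadowSets v 𝒮)) m #𝒮) hg]
  exact sum_le_sum_of_subset (image_subset_iff.2 fun i hi => mem_powerset.2 (hI i hi))

theorem card_filter_two_le_powerset {A : Finset ℕ} {j : ℕ} (hA : #A ≤ j + 1) :
    #(A.powerset.filter fun T => 2 ≤ #T) ≤ 2 ^ (j + 1) - j - 2 := by
  have hmain : ∀ k, ∀ A : Finset ℕ, #A = k + 1 →
      #(A.powerset.filter fun T => 2 ≤ #T) + k + 2 ≤ 2 ^ (k + 1) := by
    intro k A hA
    have h1 : #(A.powersetCard 0 ∪ A.powersetCard 1) = k + 2 := by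
      rw [card_union_of_disjoint (pairwise_disjoint_powersetCard A (by simp)),
        card_powersetCard, card_powersetCard, hA]
      simp; omega
    have h2 : Disjoint (A.powerset.filter fun T => 2 ≤ #T)
        (A.powersetCard 0 ∪ A.powersetCard 1) := by
      rw [Finset.disjoint_left]
      intro T hT hT'
      simp only [mem_filter, mem_union, mem_powersetCard] at hT hT'
      omega
    have h3 : (A.powerset.filter fun T => 2 ≤ #T) ∪ (A.powersetCard 0 ∪ A.powersetCard 1)
        ⊆ A.powerset := by
      refine union_subset (filter_subset _ _) (union_subset ?_ ?_) <;>
      exact fun T hT => mem_powerset.2 (mem_powersetCard.1 hT).1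
    have := card_le_card h3
    rw [card_union_of_disjoint h2, h1, card_powerset, hA] at this
    omega
  have hmono : ∀ k l, k ≤ l → 2 ^ (k + 1) - k - 2 ≤ 2 ^ (l + 1) - l - 2 := by
    intro k l h
    induction h with
    | refl => rfl
    | step h ih =>
      rename_i l
      have := Nat.lt_two_pow_self (n := l + 1)
      rw [pow_succ 2 (l + 1)]
      simp only [Nat.succ_eq_add_one] at *
      omega
  rcases Nat.eq_zero_or_pos #A with h0 | h0
  · rw [card_eq_zero] at h0
    subst h0
    rw [filter_eq_empty_iff.2 fun T hT h => by simp_all]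
    exact Nat.zero_le _
  · obtain ⟨k, hk⟩ : ∃ k, #A = k + 1 := ⟨#A - 1, by omega⟩
    have := hmain k A hk
    have := hmono k j (by omega)
    omega

theorem card_shadowSets_le (v : ℕ) (𝒮 : Finset (Finset ℕ)) {j : ℕ} (h : ∀ S ∈ 𝒮, #S ≤ j) :
    #(shadowSets v 𝒮) ≤ #𝒮 * (2 ^ (j + 1) - j - 2) := by
  refine card_biUnion_le_card_mul _ _ _ fun S hS => card_filter_two_le_powerset ?_
  exact (card_insert_le _ _).trans (by have := h S hS; omega)

theorem choose_mul_le_shadowSum (v : ℕ) {𝒬 𝒞 : Finset (Finset ℕ)} {j : ℕ} (h𝒞 : 𝒞 ⊆ 𝒬)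
    (h : ∀ S ∈ 𝒞, #S ≤ j) {N m t : ℕ} (ht : t ≤ m) :
    (#𝒞).choose t * (N - t * (2 ^ (j + 1) - j - 2)).choose (m - t) ≤ shadowSum v 𝒬 N m := by
  refine le_trans ?_ (sum_le_shadowSum v 𝒬 N m (𝒞.powersetCard t) id (Set.injOn_id _)
    fun i hi => (mem_powersetCard.1 hi).1.trans h𝒞)
  rw [← card_powersetCard, ← smul_eq_mul]
  refine card_nsmul_le_sum _ _ _ fun 𝒮 h𝒮 => ?_
  obtain ⟨h1, h2⟩ := mem_powersetCard.1 h𝒮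
  have := card_shadowSets_le v 𝒮 fun S hS => h S (h1 hS)
  rw [h2] at this
  simp only [id, chooseSub, h2, if_pos ht]
  exact Nat.choose_le_choose _ (by omega)

theorem shadowSets_pair_mem {v x : ℕ} {T : Finset ℕ} (hT : T ⊆ insert v {x}) (h2 : 2 ≤ #T) :
    T = insert v {x} :=
  eq_of_subset_of_card_le hT ((card_insert_le _ _).trans (by simpa using h2))

theorem card_shadowSets_singletons (v : ℕ) (X : Finset ℕ) :
    #(shadowSets v (X.image singleton)) ≤ #X := by
  have : shadowSets v (X.image singleton) ⊆ X.image fun x => insert v {x} := by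
    intro T hT
    simp only [shadowSets, mem_biUnion, mem_image, mem_filter, mem_powerset] at hT ⊢
    obtain ⟨S, ⟨x, hx, rfl⟩, h1, h2⟩ := hT
    exact ⟨x, hx, (shadowSets_pair_mem h1 h2).symm⟩
  exact (card_le_card this).trans card_image_le

theorem card_shadowSets_pairs (v : ℕ) (R X : Finset ℕ) (hX : X ⊆ R) (E : Finset (Finset ℕ))
    (hE : E ⊆ R.powersetCard 2) :
    #(shadowSets v (X.image singleton ∪ E)) ≤ #R + 2 * #E := by
  have : shadowSets v (X.image singleton ∪ E) ⊆
      (R.image fun x => insert v {x}) ∪ (E ∪ E.image fun S => insert v S) := by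
    intro T hT
    simp only [shadowSets, mem_biUnion, mem_image, mem_filter, mem_powerset, mem_union] at hT ⊢
    obtain ⟨S, ⟨x, hx, rfl⟩ | hS, h1, h2⟩ := hT
    · exact Or.inl ⟨x, hX hx, (shadowSets_pair_mem h1 h2).symm⟩
    · obtain ⟨hSR, hS2⟩ := mem_powersetCard.1 (hE hS)
      by_cases hv : v ∈ T
      · have hcard := card_erase_add_one hv
        have hsub : T.erase v ⊆ S := by
          intro y hy
          have := h1 (mem_of_mem_erase hy)
          rw [mem_insert] at this
          exact this.resolve_left (ne_of_mem_erase hy)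
        have hle := card_le_card hsub
        rcases Nat.lt_or_ge #(T.erase v) 2 with h | h
        · obtain ⟨x, hx⟩ := card_eq_one.1 (show #(T.erase v) = 1 by omega)
          refine Or.inl ⟨x, hSR (hsub (by simp [hx])), ?_⟩
          rw [← hx, insert_erase hv]
        · refine Or.inr (Or.inr ⟨S, hS, ?_⟩)
          rw [← eq_of_subset_of_card_le hsub (by omega), insert_erase hv]
      · refine Or.inr (Or.inl ?_)
        rwa [eq_of_subset_of_card_le (s := T) (t := S) ((subset_insert_iff_of_notMem hv).1 h1)
          (by omega)]
  refine (card_le_card this).trans ((card_union_le _ _).trans ?_)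
  have h1 := card_union_le E (E.image fun S => insert v S)
  have h2 : #(E.image fun S => insert v S) ≤ #E := card_image_le
  have h3 : #(R.image fun x => (insert v {x} : Finset ℕ)) ≤ #R := card_image_le
  omega

theorem sum_singletons_le_shadowSum (v : ℕ) (R : Finset ℕ) {𝒬 : Finset (Finset ℕ)}
    (h : R.image singleton ⊆ 𝒬) {N m : ℕ} (hm : #R ≤ m) :
    ∑ k ∈ range (#R + 1), (#R).choose k * (N - k).choose (m - k) ≤ shadowSum v 𝒬 N m := by
  refine le_trans ?_ (sum_le_shadowSum v 𝒬 N m R.powerset (fun X => X.image singleton)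
    ((image_injective singleton_injective).injOn)
    fun X hX => (image_subset_image (mem_powerset.1 hX)).trans h)
  have := Finset.sum_powerset_apply_card (fun k => (N - k).choose (m - k)) (x := R)
  simp only [smul_eq_mul] at this
  rw [← this]
  refine sum_le_sum fun X hX => ?_
  have hle := card_le_card (mem_powerset.1 hX)
  rw [card_image_of_injective _ singleton_injective, chooseSub, if_pos (by omega)]
  exact Nat.choose_le_choose _ (Nat.sub_le_sub_left (card_shadowSets_singletons v X) _)

theorem sum_pairs_le_shadowSum (v : ℕ) (R : Finset ℕ) {𝒬 : Finset (Finset ℕ)}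
    (h : R.image singleton ∪ R.powersetCard 2 ⊆ 𝒬) {N m : ℕ} (hm : #R + (#R).choose 2 ≤ m)
    (hN : #R + 2 * (#R).choose 2 ≤ N) :
    ∑ e ∈ range ((#R).choose 2 + 1), ((#R).choose 2).choose e * (N - 2 * e).choose (m - e)
      ≤ shadowSum v 𝒬 N m := by
  have hinj : Set.InjOn (fun i : Finset (Finset ℕ) × Finset ℕ => i.2.image singleton ∪ i.1)
      ((R.powersetCard 2).powerset ×ˢ R.powerset : Finset _) := by
    rintro ⟨E, X⟩ h1 ⟨E', X'⟩ h2 heq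
    simp only [coe_product, Set.mem_prod, mem_coe, mem_powerset] at h1 h2 heq
    have key : ∀ (E : Finset (Finset ℕ)) (X : Finset ℕ), E ⊆ R.powersetCard 2 →
        (X.image singleton ∪ E).filter (fun S => #S = 2) = E ∧
        (X.image singleton ∪ E).filter (fun S => #S = 1) = X.image singleton := by
      intro E X hE
      constructor <;> ext S <;> simp only [mem_filter, mem_union, mem_image] <;> constructor
      · rintro ⟨⟨x, -, rfl⟩ | h, h'⟩
        · simp at h'
        · exact h
      · exact fun h => ⟨Or.inr h, (mem_powersetCard.1 (hE h)).2⟩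
      · rintro ⟨h | h, h'⟩
        · exact h
        · have := (mem_powersetCard.1 (hE h)).2
          omega
      · rintro ⟨x, hx, rfl⟩
        exact ⟨Or.inl ⟨x, hx, rfl⟩, card_singleton x⟩
    have k1 := key E X h1.1
    have k2 := key E' X' h2.1
    rw [heq] at k1
    have e1 : E = E' := k1.1.symm.trans k2.1
    have e2 : X = X' := image_injective singleton_injective (k1.2.symm.trans k2.2)
    rw [e1, e2]
  refine le_trans ?_ (sum_le_shadowSum v 𝒬 N m _ _ hinj ?_)
  · rw [sum_product]
    have := Finset.sum_powerset_apply_card (fun e => (N - 2 * e).choose (m - e))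
      (x := R.powersetCard 2)
    simp only [smul_eq_mul, card_powersetCard] at this
    rw [← this]
    refine sum_le_sum fun E hE => ?_
    have hEle := card_le_card (mem_powerset.1 hE)
    rw [card_powersetCard] at hEle
    have hv : N - 2 * #E = #R + (N - #R - 2 * #E) := by omega
    rw [hv, Nat.add_choose_eq, Finset.Nat.sum_antidiagonal_eq_sum_range_succ
      (fun a b => (#R).choose a * (N - #R - 2 * #E).choose b)]
    have := Finset.sum_powerset_apply_card
      (fun k => (N - #R - 2 * #E).choose (m - #E - k)) (x := R)
    simp only [smul_eq_mul] at this
    have hsub : ∑ k ∈ range (m - #E).succ,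
        (#R).choose k * (N - #R - 2 * #E).choose (m - #E - k) =
        ∑ k ∈ range (#R + 1), (#R).choose k * (N - #R - 2 * #E).choose (m - #E - k) := by
      symm
      refine sum_subset (range_subset_range.2 (by omega)) fun k _ hk => ?_
      rw [Nat.choose_eq_zero_of_lt (by simpa using hk), zero_mul]
    rw [hsub, ← this]
    refine sum_le_sum fun X hX => ?_
    have hXle := card_le_card (mem_powerset.1 hX)
    have hdisj : Disjoint (X.image singleton) E := by
      rw [Finset.disjoint_left]
      intro S hS hS'
      obtain ⟨x, -, rfl⟩ := mem_image.1 hS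
      have := (mem_powersetCard.1 (mem_powerset.1 hE hS')).2
      simp at this
    have hc := card_shadowSets_pairs v R X (mem_powerset.1 hX) E (mem_powerset.1 hE)
    simp only
    rw [card_union_of_disjoint hdisj, card_image_of_injective _ singleton_injective, chooseSub,
      if_pos (by omega), show m - (#X + #E) = m - #E - #X by omega]
    exact Nat.choose_le_choose _ (by omega)
  · rintro ⟨E, X⟩ hi
    simp only [mem_product, mem_powerset] at hi
    exact (union_subset_union (image_subset_image hi.2) hi.1).trans h

theorem choose_mul_pow_le_choose_sub_sub {N m : ℕ} (hmN : m ≤ N) {a : ℕ} (ha : a ≤ m) :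
    (N.choose m : ℝ) * ((m + 1 - a) / N) ^ a ≤ ((N - a).choose (m - a) : ℕ) := by
  induction a with
  | zero => simp
  | succ a ih =>
    have ih := ih (by omega)
    obtain ⟨k, hk⟩ : ∃ k, m = k + (a + 1) := ⟨m - (a + 1), by omega⟩
    obtain ⟨K, hK⟩ : ∃ K, N = K + (a + 1) := ⟨N - (a + 1), by omega⟩
    have h1 : N - a = K + 1 := by omega
    have h2 : m - a = k + 1 := by omega
    have h3 : N - (a + 1) = K := by omega
    have h4 : m - (a + 1) = k := by omega
    have hid : ((K + 1 : ℕ) : ℝ) * K.choose k = (K + 1).choose (k + 1) * (k + 1 : ℕ) := by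
      exact_mod_cast Nat.add_one_mul_choose_eq K k
    rw [h1, h2] at ih
    rw [h3, h4]
    have hN : (0 : ℝ) < N := by rw [hK]; positivity
    have hNK : ((K + 1 : ℕ) : ℝ) ≤ N := by rw [hK]; push_cast; linarith
    have e1 : ((m : ℝ) + 1 - ((a + 1 : ℕ) : ℝ)) / N = (k + 1 : ℕ) / N := by
      rw [hk]; push_cast; ring
    have e2 : ((m : ℝ) + 1 - (a : ℝ)) / N = (k + 2 : ℕ) / N := by
      rw [hk]; push_cast; ring
    rw [e1]
    rw [e2] at ih
    have hle : (((k + 1 : ℕ) : ℝ) / N) ^ a ≤ (((k + 2 : ℕ) : ℝ) / N) ^ a := by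
      gcongr; omega
    calc (N.choose m : ℝ) * ((k + 1 : ℕ) / N) ^ (a + 1)
        = (N.choose m : ℝ) * ((k + 1 : ℕ) / N) ^ a * ((k + 1 : ℕ) / N) := by ring
      _ ≤ (N.choose m : ℝ) * ((k + 2 : ℕ) / N) ^ a * ((k + 1 : ℕ) / N) := by gcongr
      _ ≤ ((K + 1).choose (k + 1) : ℕ) * ((k + 1 : ℕ) / N) := by gcongr
      _ = ((K + 1 : ℕ) * K.choose k) / N := by rw [hid]; ring
      _ ≤ (N * K.choose k) / N := by gcongr
      _ = K.choose k := by field_simp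

theorem choose_mul_pow_le_choose_sub {N m b : ℕ} (h : m + b < N) :
    (N.choose m : ℝ) * (1 - m / (N - b)) ^ b ≤ ((N - b).choose m : ℕ) := by
  have hNb : (m : ℝ) + b < N := by exact_mod_cast h
  have key : ∀ c ≤ b, (N.choose m : ℝ) * (1 - m / (N - b)) ^ c ≤ ((N - c).choose m : ℕ) := by
    intro c hc
    induction c with
    | zero => simp
    | succ c ih =>
      have ih := ih (by omega)
      obtain ⟨K, hK⟩ : ∃ K, N = K + (c + 1) := ⟨N - (c + 1), by omega⟩
      rw [show N - c = K + 1 by omega] at ih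
      rw [show N - (c + 1) = K by omega]
      have hid : ((K + 1 : ℕ) : ℝ) * K.choose m = (K + 1).choose m * ((K + 1 : ℕ) - m) := by
        have := Nat.choose_mul_succ_eq K m
        rw [← Nat.cast_sub (by omega)]
        rw [mul_comm]
        exact_mod_cast this
      have hpos : (0 : ℝ) < (N : ℝ) - b := by linarith [(Nat.cast_nonneg m : (0 : ℝ) ≤ m)]
      have hK1 : (N : ℝ) - b ≤ (K + 1 : ℕ) := by
        have : ((c + 1 : ℕ) : ℝ) ≤ b := by exact_mod_cast hc
        rw [hK]; push_cast at *; linarith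
      have h0 : (0 : ℝ) ≤ 1 - m / (N - b) := by
        rw [sub_nonneg, div_le_one hpos]; linarith
      have h1 : (1 : ℝ) - m / (N - b) ≤ ((K + 1 : ℕ) - m) / (K + 1 : ℕ) := by
        rw [sub_div, div_self (by positivity)]
        gcongr
      calc (N.choose m : ℝ) * (1 - m / (N - b)) ^ (c + 1)
          = (N.choose m : ℝ) * (1 - m / (N - b)) ^ c * (1 - m / (N - b)) := by ring
        _ ≤ ((K + 1).choose m : ℕ) * (((K + 1 : ℕ) - m) / (K + 1 : ℕ)) := by gcongr
        _ = ((K + 1 : ℕ) * K.choose m) / (K + 1 : ℕ) := by rw [hid]; ring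
        _ = K.choose m := by field_simp
  exact key b le_rfl

theorem choose_mul_pow_mul_pow_le {N m a b : ℕ} (ha : a ≤ m) (h : m + a + b < N) :
    (N.choose m : ℝ) * ((m + 1 - a) / N) ^ a * (1 - m / (N - a - b)) ^ b
      ≤ ((N - a - b).choose (m - a) : ℕ) := by
  have h1 := choose_mul_pow_le_choose_sub_sub (N := N) (by omega) ha
  have h2 := choose_mul_pow_le_choose_sub (N := N - a) (m := m - a) (b := b) (by omega)
  refine le_trans ?_ h2
  have hNab : (m : ℝ) + a + b < N := by exact_mod_cast h
  have hm : (a : ℝ) ≤ m := by exact_mod_cast ha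
  have ha0 : (0 : ℝ) ≤ a := Nat.cast_nonneg a
  rw [Nat.cast_sub (show a ≤ N by omega), Nat.cast_sub ha]
  have hpos : (0 : ℝ) < (N : ℝ) - a - b := by linarith
  have h0 : (0 : ℝ) ≤ 1 - m / (N - a - b) := by
    rw [sub_nonneg, div_le_one hpos]; linarith
  refine mul_le_mul h1 ?_ (by positivity) (by positivity)
  gcongr
  linarith

theorem sum_singletons_lower {N m r : ℕ} (hr : r ≤ m) (hmN : m ≤ N) :
    (N.choose m : ℝ) * (1 + (m + 1 - r) / N) ^ r
      ≤ (∑ k ∈ range (r + 1), r.choose k * (N - k).choose (m - k) : ℕ) := by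
  rw [add_comm, add_pow, mul_sum]
  push_cast
  refine sum_le_sum fun k hk => ?_
  have hk : k ≤ r := by simpa [Nat.lt_succ_iff] using hk
  have h := choose_mul_pow_le_choose_sub_sub hmN (hk.trans hr)
  have hrm : (r : ℝ) ≤ m := by exact_mod_cast hr
  have hkr : (k : ℝ) ≤ r := by exact_mod_cast hk
  have hle : (((m : ℝ) + 1 - r) / N) ^ k ≤ ((m + 1 - k) / N) ^ k := by
    have : (0 : ℝ) ≤ ((m : ℝ) + 1 - r) / N := div_nonneg (by linarith) (by positivity)
    gcongr
  calc (N.choose m : ℝ) * ((((m : ℝ) + 1 - r) / N) ^ k * 1 ^ (r - k) * r.choose k)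
      = r.choose k * (N.choose m * (((m : ℝ) + 1 - r) / N) ^ k) := by rw [one_pow]; ring
    _ ≤ r.choose k * (N.choose m * (((m : ℝ) + 1 - k) / N) ^ k) := by gcongr
    _ ≤ _ := by gcongr

theorem sum_pairs_lower {N m D : ℕ} (hD : D ≤ m) (hmN : m + 2 * D < N) :
    (N.choose m : ℝ) * (1 + (m + 1 - D) / N * (1 - m / (N - D - D))) ^ D
      ≤ (∑ e ∈ range (D + 1), D.choose e * (N - 2 * e).choose (m - e) : ℕ) := by
  rw [add_comm, add_pow, mul_sum]
  push_cast
  refine sum_le_sum fun e he => ?_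
  have he : e ≤ D := by simpa [Nat.lt_succ_iff] using he
  have h := choose_mul_pow_mul_pow_le (N := N) (he.trans hD) (b := e) (by omega)
  have hDm : (D : ℝ) ≤ m := by exact_mod_cast hD
  have heD : (e : ℝ) ≤ D := by exact_mod_cast he
  have hN : (m : ℝ) + 2 * D < N := by exact_mod_cast hmN
  have hD0 : (0 : ℝ) ≤ D := Nat.cast_nonneg D
  have hpos : (0 : ℝ) < (N : ℝ) - D - D := by linarith
  have h1 : (0 : ℝ) ≤ ((m : ℝ) + 1 - D) / N := div_nonneg (by linarith) (by positivity)
  have h2 : (0 : ℝ) ≤ 1 - m / (N - D - D) := by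
    rw [sub_nonneg, div_le_one hpos]; linarith
  have h3 : ((m : ℝ) + 1 - D) / N ≤ (m + 1 - e) / N := by gcongr
  have h4 : (1 : ℝ) - m / (N - D - D) ≤ 1 - m / (N - e - e) := by gcongr
  have h5 : (0 : ℝ) ≤ (m + 1 - e) / N := h1.trans h3
  rw [show N - e - e = N - 2 * e by omega] at h
  calc (N.choose m : ℝ) *
        ((((m : ℝ) + 1 - D) / N * (1 - m / (N - D - D))) ^ e * 1 ^ (D - e) * D.choose e)
      = D.choose e * (N.choose m * (((m : ℝ) + 1 - D) / N) ^ e * (1 - m / (N - D - D)) ^ e) := by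
        rw [one_pow, mul_pow]; ring
    _ ≤ D.choose e * (N.choose m * (((m : ℝ) + 1 - e) / N) ^ e * (1 - m / (N - e - e)) ^ e) := by
        gcongr
    _ ≤ _ := by gcongr

theorem shadowSum_lower_of_card (v : ℕ) {𝒬 𝒞 : Finset (Finset ℕ)} {j : ℕ} (h𝒞 : 𝒞 ⊆ 𝒬)
    (h : ∀ S ∈ 𝒞, #S ≤ j) {N m t κ : ℕ} (hκ : 2 ^ (j + 1) - j - 2 = κ + 1) (htκ : t * (κ + 1) ≤ 502)
    (ht : t ≤ m) (hN : 2 ^ 19 ≤ N) {β : ℝ} (hβ : m ≤ β * N) (hβ1 : β ≤ 9 / 10) :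
    (#𝒞).choose t * ((N.choose m : ℝ) * ((m + 1 - t) / N) ^ t * (1 - 1.001 * β) ^ (t * κ))
      ≤ shadowSum v 𝒬 N m := by
  have h1 := choose_mul_le_shadowSum v h𝒞 h (N := N) ht
  rw [hκ] at h1
  have hNr : (2 : ℝ) ^ 19 ≤ N := by exact_mod_cast hN
  have htκr : (t : ℝ) * (κ + 1) ≤ 502 := by exact_mod_cast htκ
  have hlt : m + t + t * κ < N := by
    have : (m : ℝ) + t + t * κ < N := by nlinarith
    exact_mod_cast this
  have h2 := choose_mul_pow_mul_pow_le ht hlt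
  rw [show N - t - t * κ = N - t * (κ + 1) by rw [Nat.sub_sub]; ring_nf] at h2
  have htm : (t : ℝ) ≤ m := by exact_mod_cast ht
  have h0 : (0 : ℝ) ≤ ((m : ℝ) + 1 - t) / N := div_nonneg (by linarith) (by positivity)
  have hpos : (0 : ℝ) < (N : ℝ) - t - (t * κ : ℕ) := by push_cast; nlinarith
  have h3 : (1 : ℝ) - 1.001 * β ≤ 1 - m / (N - t - (t * κ : ℕ)) := by
    have : (m : ℝ) / (N - t - (t * κ : ℕ)) ≤ 1.001 * β := by
      rw [div_le_iff₀ hpos]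
      push_cast
      have hβ0 : 0 ≤ β := by
        by_contra! hneg
        have : (0 : ℝ) ≤ m := Nat.cast_nonneg m
        nlinarith
      have : (N : ℝ) ≤ 1.001 * (N - t - t * κ) := by nlinarith
      nlinarith
    linarith
  have h4 : (0 : ℝ) ≤ 1 - 1.001 * β := by norm_num; linarith
  calc ((#𝒞).choose t : ℝ) * (N.choose m * ((m + 1 - t) / N) ^ t * (1 - 1.001 * β) ^ (t * κ))
      ≤ (#𝒞).choose t * (N.choose m * ((m + 1 - t) / N) ^ t
          * (1 - m / (N - t - (t * κ : ℕ))) ^ (t * κ)) := by gcongr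
    _ ≤ (#𝒞).choose t * ((N - t * (κ + 1)).choose (m - t) : ℕ) := by gcongr
    _ ≤ shadowSum v 𝒬 N m := by exact_mod_cast h1

theorem choose_five_six_seven_eight_lower {r : ℕ} (hr : 17 ≤ r) :
    26.18 * (r.choose 4 : ℝ) ≤ r.choose 5 + r.choose 6 + r.choose 7 + r.choose 8 ∧
      2.6 * (r.choose 4 : ℝ) ≤ r.choose 5 := by
  have h : ∀ k c : ℕ, c + k ≤ r → (c : ℝ) * r.choose k ≤ (k + 1) * r.choose (k + 1) := by
    intro k c hc
    have h1 := Nat.choose_succ_right_eq r k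
    have h2 : c * r.choose k ≤ (k + 1) * r.choose (k + 1) := by
      rw [mul_comm (k + 1), h1, mul_comm]
      exact Nat.mul_le_mul_left _ (by omega)
    exact_mod_cast h2
  have h4 := h 4 13 (by omega)
  have h5 := h 5 12 (by omega)
  have h6 := h 6 11 (by omega)
  have h7 := h 7 10 (by omega)
  norm_num at h4 h5 h6 h7
  have : (0 : ℝ) ≤ r.choose 4 := Nat.cast_nonneg _
  constructor <;> norm_num <;> linarith

theorem choose_three_lower {r : ℕ} (hr : 17 ≤ r) :
    680 ≤ r.choose 3 ∧ 680 * (r - 3) ≤ 14 * r.choose 3 := by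
  induction r, hr using Nat.le_induction with
  | base => decide
  | succ r hr ih =>
    have h2 : Nat.choose 17 2 ≤ r.choose 2 := Nat.choose_le_choose 2 hr
    have h3 : Nat.choose 17 2 = 136 := by decide
    have := Nat.choose_succ_succ' r 2
    norm_num at this
    omega

theorem choose_three_sq_lower {r : ℕ} (hr : 17 ≤ r) :
    194.28 * (r.choose 4 : ℝ) ≤ (r.choose 3 : ℝ) ^ 2 := by
  have h1 := Nat.choose_succ_right_eq r 3
  obtain ⟨-, h2⟩ := choose_three_lower hr
  have h3 : 680 * (r.choose 4 * 4) ≤ 14 * r.choose 3 ^ 2 := by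
    rw [h1]
    calc 680 * (r.choose 3 * (r - 3)) = r.choose 3 * (680 * (r - 3)) := by ring
      _ ≤ r.choose 3 * (14 * r.choose 3) := Nat.mul_le_mul_left _ h2
      _ = _ := by ring
  have h4 : (680 : ℝ) * (r.choose 4 * 4) ≤ 14 * (r.choose 3 : ℝ) ^ 2 := by exact_mod_cast h3
  have : (0 : ℝ) ≤ r.choose 4 := Nat.cast_nonneg _
  norm_num
  linarith

theorem choose_choose_five_four_lower {r : ℕ} (hr : 17 ≤ r) :
    2.56e10 * (r.choose 4 : ℝ) ≤ ((r.choose 5).choose 4 : ℕ) := by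
  obtain ⟨-, h1⟩ := choose_five_six_seven_eight_lower hr
  have h2 : Nat.choose 17 5 ≤ r.choose 5 := Nat.choose_le_choose 5 hr
  rw [show Nat.choose 17 5 = 6188 by decide] at h2
  have h3 := Nat.pow_le_choose 4 (r.choose 5) (α := ℝ)
  generalize r.choose 5 = M at *
  have h2r : (6188 : ℝ) ≤ M := by exact_mod_cast h2
  have h4 : ((M + 1 - 4 : ℕ) : ℝ) = M - 3 := by
    rw [Nat.cast_sub (by omega)]; push_cast; ring
  rw [h4] at h3
  have h5 : (6185 : ℝ) ^ 3 ≤ (M - 3) ^ 3 := by gcongr; linarith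
  have h6 : 2.598 * (r.choose 4 : ℝ) ≤ M - 3 := by
    norm_num at h1 ⊢; linarith
  have h7 : (6185 : ℝ) ^ 3 * (2.598 * (r.choose 4 : ℝ)) ≤ (M - 3) ^ 3 * (M - 3) :=
    mul_le_mul h5 h6 (by positivity) (by have : (0:ℝ) ≤ M - 3 := by linarith
                                         positivity)
  have h8 : ((Nat.factorial 4 : ℕ) : ℝ) = 24 := by norm_num [Nat.factorial]
  rw [h8] at h3
  have : (0 : ℝ) ≤ r.choose 4 := Nat.cast_nonneg _
  norm_num at h7 ⊢
  linarith

theorem choose_choose_three_six_lower {r : ℕ} (hr : 17 ≤ r) :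
    5.5e10 * (r.choose 4 : ℝ) ≤ ((r.choose 3).choose 6 : ℕ) := by
  have h1 := choose_three_sq_lower hr
  obtain ⟨h2, -⟩ := choose_three_lower hr
  have h3 := Nat.pow_le_choose 6 (r.choose 3) (α := ℝ)
  generalize r.choose 3 = M at *
  have h2r : (680 : ℝ) ≤ M := by exact_mod_cast h2
  have h4 : ((M + 1 - 6 : ℕ) : ℝ) = M - 5 := by
    rw [Nat.cast_sub (by omega)]; push_cast; ring
  rw [h4] at h3
  have h5 : (675 : ℝ) ^ 4 ≤ (M - 5) ^ 4 := by gcongr; linarith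
  have h6 : 191.3 * (r.choose 4 : ℝ) ≤ (M - 5) ^ 2 := by
    have h9 : (0.9926 * (M : ℝ)) ^ 2 ≤ (M - 5) ^ 2 := by gcongr; norm_num; linarith
    have : (0 : ℝ) ≤ r.choose 4 := Nat.cast_nonneg _
    rw [mul_pow] at h9
    norm_num at h1 h9 ⊢; linarith
  have h7 : (675 : ℝ) ^ 4 * (191.3 * (r.choose 4 : ℝ)) ≤ (M - 5) ^ 4 * (M - 5) ^ 2 :=
    mul_le_mul h5 h6 (by positivity) (by positivity)
  have h8 : ((Nat.factorial 6 : ℕ) : ℝ) = 720 := by norm_num [Nat.factorial]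
  rw [h8, show (6 : ℕ) = 4 + 2 by norm_num, pow_add] at h3
  have : (0 : ℝ) ≤ r.choose 4 := Nat.cast_nonneg _
  norm_num at h7 h3 ⊢
  linarith

theorem fourteen_mul_choose_four_le {r : ℕ} (hr : 17 ≤ r) : 14 * (r.choose 4 : ℝ) ≤ 1.87 ^ r := by
  induction r, hr using Nat.le_induction with
  | base =>
    rw [show Nat.choose 17 4 = 2380 by decide]; norm_num
  | succ r hr ih =>
    have h1 := Nat.choose_mul_succ_eq r 4
    have h2 : (r + 1).choose 4 * 14 ≤ r.choose 4 * 18 := by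
      have h3 : (r + 1).choose 4 * (r + 1 - 4) * 14 ≤ r.choose 4 * 18 * (r + 1 - 4) := by
        rw [← h1]
        calc r.choose 4 * (r + 1) * 14 = r.choose 4 * ((r + 1) * 14) := by ring
          _ ≤ r.choose 4 * (18 * (r + 1 - 4)) := Nat.mul_le_mul_left _ (by omega)
          _ = _ := by ring
      have hpos : 0 < r + 1 - 4 := by omega
      refine Nat.le_of_mul_le_mul_right ?_ hpos
      linarith
    have h3 : ((r + 1).choose 4 : ℝ) * 14 ≤ r.choose 4 * 18 := by exact_mod_cast h2
    rw [pow_succ]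
    have : (0 : ℝ) ≤ r.choose 4 := Nat.cast_nonneg _
    norm_num at ih ⊢
    linarith

theorem three_thousand_mul_choose_two_le {r : ℕ} (hr : 17 ≤ r) :
    3000 * r.choose 2 ≤ 2 ^ (r + 2) ∧ 8 * r ≤ r.choose 2 := by
  induction r, hr using Nat.le_induction with
  | base => decide
  | succ r hr ih =>
    have := Nat.choose_succ_succ' r 1
    norm_num at this
    rw [show r + 1 + 2 = (r + 2) + 1 by ring, pow_succ]
    omega

theorem shadowSum_ge_of_sparse (v : ℕ) {𝒬 𝒞 : Finset (Finset ℕ)} {j : ℕ} (h𝒞 : 𝒞 ⊆ 𝒬)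
    (h : ∀ S ∈ 𝒞, #S ≤ j) {N m t κ : ℕ} (hκ : 2 ^ (j + 1) - j - 2 = κ + 1)
    (htκ : (t + 1) * (κ + 1) ≤ 502) (ht : t + 1 ≤ m) (hN : 2 ^ 19 ≤ N) {α β c G q : ℝ}
    (hβ : m ≤ β * N) (hβ1 : β ≤ 9 / 10) (hα0 : 0 ≤ α) (hα : α * N ≤ m)
    (hc0 : 0 ≤ c) (hc : c * m ≤ m - t) (hq : 0 ≤ q)
    (hG : G * q ≤ ((#𝒞).choose (t + 1) : ℕ))
    (hE : 14 ≤ G * (c ^ (t + 1) * α ^ t * (1 - 1.001 * β) ^ ((t + 1) * κ))) :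
    14 * q * m * N.choose m ≤ N * (shadowSum v 𝒬 N m : ℝ) := by
  have h1 := shadowSum_lower_of_card v h𝒞 h hκ htκ ht hN hβ hβ1
  have hNr : (2 : ℝ) ^ 19 ≤ N := by exact_mod_cast hN
  have hN0 : (0 : ℝ) < N := by linarith [show (0 : ℝ) < 2 ^ 19 by norm_num]
  set E := (1 - 1.001 * β) ^ ((t + 1) * κ)
  have hE0 : 0 ≤ E := pow_nonneg (by norm_num; linarith) _
  set x : ℝ := m / N
  have hx : N * x = m := by simp only [x]; field_simp
  have hx0 : 0 ≤ x := by positivity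
  have hαx : α ≤ x := by rw [le_div_iff₀ hN0]; exact hα
  have hcx : c * x ≤ (m + 1 - (t + 1 : ℕ)) / N := by
    have : c * x * N = c * m := by rw [← hx]; ring
    rw [le_div_iff₀ hN0]; push_cast; linarith
  have h2 : (c * x) ^ (t + 1) ≤ (((m : ℝ) + 1 - (t + 1 : ℕ)) / N) ^ (t + 1) := by gcongr
  have h3 : c ^ (t + 1) * α ^ t * x ≤ (c * x) ^ (t + 1) := by
    rw [mul_pow, pow_succ x, ← mul_assoc]
    gcongr
  have hX : (0 : ℝ) ≤ N.choose m := Nat.cast_nonneg _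
  calc 14 * q * m * N.choose m = N * (14 * (q * x * N.choose m)) := by rw [← hx]; ring
    _ ≤ N * (G * (c ^ (t + 1) * α ^ t * E) * (q * x * N.choose m)) := by gcongr
    _ = N * (G * q * (N.choose m * (c ^ (t + 1) * α ^ t * x) * E)) := by ring
    _ ≤ N * (((#𝒞).choose (t + 1) : ℕ) *
          (N.choose m * (((m : ℝ) + 1 - (t + 1 : ℕ)) / N) ^ (t + 1) * E)) := by
        gcongr
        exact h3.trans h2
    _ ≤ N * (shadowSum v 𝒬 N m : ℝ) := by gcongr

theorem shadowSum_ge_of_pow (v : ℕ) {𝒬 : Finset (Finset ℕ)} {r N m e : ℕ} (hr : 17 ≤ r)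
    (hmN : m ≤ N) {z : ℝ} (he : (1.87 : ℝ) ^ r ≤ (1 + z) ^ e)
    (h : N.choose m * (1 + z) ^ e ≤ (shadowSum v 𝒬 N m : ℝ)) :
    14 * (r.choose 4 : ℝ) * m * N.choose m ≤ N * (shadowSum v 𝒬 N m : ℝ) := by
  have h1 := fourteen_mul_choose_four_le hr
  have hmN' : (m : ℝ) ≤ N := by exact_mod_cast hmN
  calc 14 * (r.choose 4 : ℝ) * m * N.choose m
      = m * (N.choose m * (14 * (r.choose 4 : ℝ))) := by ring
    _ ≤ N * (N.choose m * (1 + z) ^ e) := by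
        gcongr
        exact h1.trans he
    _ ≤ _ := by gcongr

theorem shadowSum_lower (v : ℕ) {R : Finset ℕ} (hr : 17 ≤ #R) {𝒬 : Finset (Finset ℕ)}
    (h𝒬 : ∀ S ⊆ R, S.Nonempty → #S ≤ 8 → S ∈ 𝒬) {N m : ℕ} (hN : 2 ^ (#R + 2) ≤ N) (hm : 1 ≤ m)
    (hmN : m ≤ N) : 14 * (#R).choose 4 * m * N.choose m ≤ N * shadowSum v 𝒬 N m := by
  have hcard : ∀ k, 1 ≤ k → k ≤ 8 → R.powersetCard k ⊆ 𝒬 := by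
    intro k hk1 hk8 S hS
    obtain ⟨h1, h2⟩ := mem_powersetCard.1 hS
    exact h𝒬 S h1 (card_pos.1 (by omega)) (by omega)
  have hsing : R.image singleton ⊆ 𝒬 := by
    intro S hS
    obtain ⟨x, hx, rfl⟩ := mem_image.1 hS
    exact h𝒬 _ (by simpa using hx) (by simp) (by simp)
  have hN19 : 2 ^ 19 ≤ N := (Nat.pow_le_pow_right (by norm_num) (by omega)).trans hN
  have hNr : (524288 : ℝ) ≤ N := by exact_mod_cast hN19
  have hN0 : (0 : ℝ) < N := by linarith
  have hq : (0 : ℝ) ≤ (#R).choose 4 := Nat.cast_nonneg _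
  have hm1 : (1 : ℝ) ≤ m := by exact_mod_cast hm
  have hmNr : (m : ℝ) ≤ N := by exact_mod_cast hmN
  suffices H : 14 * ((#R).choose 4 : ℝ) * m * N.choose m ≤ N * (shadowSum v 𝒬 N m : ℝ) by
    exact_mod_cast H
  rcases le_or_gt (m : ℝ) (0.001 * N) with hp | hp
  · have hdisj : ∀ k l, k ≠ l → Disjoint (R.powersetCard k) (R.powersetCard l) := fun k l hkl =>
      pairwise_disjoint_powersetCard R hkl
    refine shadowSum_ge_of_sparse v (𝒞 := R.powersetCard 5 ∪ R.powersetCard 6 ∪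
      (R.powersetCard 7 ∪ R.powersetCard 8)) (j := 8) (t := 0) (κ := 501) (c := 1) (α := 0)
      (G := 26.18) ?_ ?_ (by norm_num) (by norm_num) (by omega) hN19 hp (by norm_num) le_rfl
      (by simp) (by norm_num) (by simp) hq ?_ ?_
    · exact union_subset (union_subset (hcard _ (by norm_num) (by norm_num))
        (hcard _ (by norm_num) (by norm_num))) (union_subset (hcard _ (by norm_num) (by norm_num))
        (hcard _ (by norm_num) (by norm_num)))
    · intro S hS
      simp only [mem_union, mem_powersetCard] at hS
      omega
    · rw [card_union_of_disjoint, card_union_of_disjoint, card_union_of_disjoint,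
        card_powersetCard, card_powersetCard, card_powersetCard, card_powersetCard,
        Nat.choose_one_right]
      · push_cast
        linarith [(choose_five_six_seven_eight_lower hr).1]
      · exact hdisj _ _ (by norm_num)
      · exact hdisj _ _ (by norm_num)
      · simp only [disjoint_union_left, disjoint_union_right]
        refine ⟨⟨?_, ?_⟩, ?_, ?_⟩ <;> exact hdisj _ _ (by norm_num)
    · have h1 : (0.845 : ℝ) ≤ (1 - 1.001 * 0.001) ^ 167 := by norm_num
      have h2 : (0.845 : ℝ) ^ 3 ≤ (1 - 1.001 * 0.001) ^ 501 := by
        rw [show 501 = 167 * 3 by norm_num, pow_mul]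
        gcongr
      calc (14 : ℝ) ≤ 26.18 * 0.845 ^ 3 := by norm_num
        _ ≤ 26.18 * (1 - 1.001 * 0.001) ^ 501 := mul_le_mul_of_nonneg_left h2 (by norm_num)
        _ = _ := by simp
  have four : ∀ α β : ℝ, 0.001 ≤ α → β ≤ 9 / 10 → α * N ≤ m → m ≤ β * N →
      14 ≤ 2.56e10 * ((0.994 : ℝ) ^ 4 * α ^ 3 * (1 - 1.001 * β) ^ 224) →
      14 * ((#R).choose 4 : ℝ) * m * N.choose m ≤ N * (shadowSum v 𝒬 N m : ℝ) := by
    intro α β hα0 hβ1 hα hβ hE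
    refine shadowSum_ge_of_sparse v (𝒞 := R.powersetCard 5) (j := 5) (t := 3) (κ := 56)
      (c := 0.994) (hcard _ (by norm_num) (by norm_num)) ?_ (by norm_num) (by norm_num) ?_ hN19 hβ
      hβ1 (by norm_num at hα0 ⊢; linarith) hα (by norm_num) ?_ hq (G := 2.56e10) ?_ hE
    · exact fun S hS => (mem_powersetCard.1 hS).2.le
    · have : (4 : ℝ) ≤ m := by norm_num at hp; linarith
      exact_mod_cast this
    · norm_num at hp ⊢; linarith
    · rw [card_powersetCard]; exact choose_choose_five_four_lower hr
  have six : ∀ α β : ℝ, 0.04 ≤ α → β ≤ 9 / 10 → α * N ≤ m → m ≤ β * N →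
      14 ≤ 5.5e10 * ((0.999 : ℝ) ^ 6 * α ^ 5 * (1 - 1.001 * β) ^ 60) →
      14 * ((#R).choose 4 : ℝ) * m * N.choose m ≤ N * (shadowSum v 𝒬 N m : ℝ) := by
    intro α β hα0 hβ1 hα hβ hE
    have hm' : (5000 : ℝ) ≤ m := by norm_num at hα0; nlinarith
    refine shadowSum_ge_of_sparse v (𝒞 := R.powersetCard 3) (j := 3) (t := 5) (κ := 10)
      (c := 0.999) (hcard _ (by norm_num) (by norm_num)) ?_ (by norm_num) (by norm_num) ?_ hN19 hβ
      hβ1 (by norm_num at hα0 ⊢; linarith) hα (by norm_num) ?_ hq (G := 5.5e10) ?_ hE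
    · exact fun S hS => (mem_powersetCard.1 hS).2.le
    · have : (6 : ℝ) ≤ m := by linarith
      exact_mod_cast this
    · norm_num; linarith
    · rw [card_powersetCard]; exact choose_choose_three_six_lower hr
  rcases le_or_gt (m : ℝ) (0.002 * N) with hp2 | hp2
  · exact four 0.001 0.002 (by norm_num) (by norm_num) hp.le hp2 (by norm_num)
  rcases le_or_gt (m : ℝ) (0.01 * N) with hp3 | hp3
  · exact four 0.002 0.01 (by norm_num) (by norm_num) hp2.le hp3 (by norm_num)
  rcases le_or_gt (m : ℝ) (0.03 * N) with hp4 | hp4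
  · exact four 0.01 0.03 (by norm_num) (by norm_num) hp3.le hp4 (by norm_num)
  rcases le_or_gt (m : ℝ) (0.04 * N) with hp5 | hp5
  · exact four 0.03 0.04 (by norm_num) (by norm_num) hp4.le hp5 (by norm_num)
  rcases le_or_gt (m : ℝ) (0.07 * N) with hp6 | hp6
  · exact six 0.04 0.07 (by norm_num) (by norm_num) hp5.le hp6 (by norm_num)
  rcases le_or_gt (m : ℝ) (0.1 * N) with hp7 | hp7
  · exact six 0.07 0.1 (by norm_num) (by norm_num) hp6.le hp7 (by norm_num)
  obtain ⟨hD, hDr⟩ := three_thousand_mul_choose_two_le hr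
  have hDN := hD.trans hN
  have hDNr : 3000 * ((#R).choose 2 : ℝ) ≤ N := by exact_mod_cast hDN
  have hrD : 8 * (#R : ℝ) ≤ (#R).choose 2 := by exact_mod_cast hDr
  have hr0 : (17 : ℝ) ≤ #R := by exact_mod_cast hr
  norm_num at hp7
  rcases le_or_gt (m : ℝ) (0.9 * N) with hp8 | hp8
  · norm_num at hp8
    have hm1 : #R + (#R).choose 2 ≤ m := by
      have : (#R : ℝ) + (#R).choose 2 ≤ m := by linarith
      exact_mod_cast this
    have hm2 : m + 2 * (#R).choose 2 < N := by
      have : (m : ℝ) + 2 * (#R).choose 2 < N := by linarith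
      exact_mod_cast this
    have h1 := sum_pairs_le_shadowSum v R (union_subset hsing
      (hcard 2 (by norm_num) (by norm_num))) hm1 (N := N) (by omega)
    have h2 := sum_pairs_lower (N := N) (m := m) (D := (#R).choose 2) (by omega) hm2
    generalize (#R).choose 2 = D at *
    have hz : (0.0815 : ℝ) ≤ (m + 1 - D) / N * (1 - m / (N - D - D)) := by
      set p : ℝ := m / N
      have hp : m = p * N := by simp only [p]; field_simp
      have hp1 : 1 / 10 ≤ p := by rw [le_div_iff₀ hN0]; linarith
      have hp2 : p ≤ 9 / 10 := by rw [div_le_iff₀ hN0]; linarith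
      have ha : p - 1 / 3000 ≤ (m + 1 - D) / N := by
        rw [le_div_iff₀ hN0, hp]; linarith
      have hb : (m : ℝ) / (N - D - D) ≤ 1.0007 * p := by
        rw [div_le_iff₀ (by linarith), hp]
        have : (N : ℝ) ≤ 1.0007 * (N - D - D) := by norm_num; linarith
        nlinarith
      have hb' : 1 - 1.0007 * p ≤ 1 - m / (N - D - D) := by linarith
      have hc : (0 : ℝ) ≤ 1 - 1.0007 * p := by norm_num; linarith
      calc (0.0815 : ℝ) ≤ (p - 1 / 3000) * (1 - 1.0007 * p) := by
            norm_num; nlinarith [mul_nonneg (sub_nonneg.2 hp1) (sub_nonneg.2 hp2)]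
        _ ≤ _ := mul_le_mul ha hb' hc (by linarith)
    refine shadowSum_ge_of_pow v hr hmN ?_
      (h2.trans (by exact_mod_cast h1))
    calc (1.87 : ℝ) ^ #R ≤ ((1 + 0.0815) ^ 8) ^ #R := by gcongr; norm_num
      _ = (1 + 0.0815) ^ (8 * #R) := by rw [pow_mul]
      _ ≤ (1 + 0.0815) ^ D := pow_le_pow_right₀ (by norm_num) hDr
      _ ≤ _ := by gcongr
  · norm_num at hp8
    have hm1 : #R ≤ m := by
      have : (#R : ℝ) ≤ m := by linarith
      exact_mod_cast this
    have h1 := sum_singletons_le_shadowSum v R hsing hm1 (N := N)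
    have h2 := sum_singletons_lower hm1 hmN
    have hz : (0.87 : ℝ) ≤ (m + 1 - #R) / N := by
      rw [le_div_iff₀ hN0]; norm_num; linarith
    refine shadowSum_ge_of_pow v hr hmN ?_
      (h2.trans (by exact_mod_cast h1))
    gcongr
    norm_num at hz ⊢
    linarith

theorem le_shadowSum_insert_empty_of_large (v : ℕ) {R : Finset ℕ} (hr : 17 ≤ #R)
    {𝒬 : Finset (Finset ℕ)} (h𝒬 : ∀ S ⊆ R, S.Nonempty → #S ≤ 8 → S ∈ 𝒬) (h0 : ∅ ∉ 𝒬) {N m : ℕ}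
    (hN : 2 ^ (#R + 2) ≤ N + 1) :
    14 * (#R).choose 4 * N.choose m ≤ shadowSum v (insert ∅ 𝒬) N (m + 1) := by
  rcases Nat.lt_or_ge N m with h | h
  · simp [Nat.choose_eq_zero_of_lt h]
  refine le_trans ?_ (shadowSum_insert_empty v 𝒬 h0 N m)
  have h1 := shadowSum_lower v hr h𝒬 hN (m := m + 1) (by omega) (by omega)
  refine Nat.le_of_mul_le_mul_left ?_ (Nat.succ_pos N)
  refine le_trans (le_of_eq ?_) h1
  have := Nat.add_one_mul_choose_eq N m
  calc (N + 1) * (14 * (#R).choose 4 * N.choose m)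
      = 14 * (#R).choose 4 * ((N + 1) * N.choose m) := by ring
    _ = _ := by rw [this]; ring

theorem le_shadowSum_insert_empty_singletons (v : ℕ) (R : Finset ℕ) (N m : ℕ) :
    (#R + 1) * N.choose m ≤ shadowSum v (insert ∅ (R.image singleton)) N (m + 1) := by
  refine le_trans ?_ (shadowSum_insert_empty v _ (by simp) N m)
  have h1 := sum_le_shadowSum v (R.image singleton) (N + 1) (m + 1) (insert ∅ (R.image singleton))
    (fun X : Finset ℕ => X.image singleton) (image_injective singleton_injective).injOn (by
      intro X hX
      refine image_subset_image ?_
      simp only [mem_insert, mem_image] at hX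
      rcases hX with rfl | ⟨x, hx, rfl⟩
      · simp
      · simpa using hx)
  refine le_trans ?_ h1
  rw [sum_insert (by simp), add_mul, add_comm, sum_image singleton_injective.injOn]
  refine Nat.add_le_add ?_ ?_
  · have h2 : chooseSub (N + 1) (m + 1) 0 = (N + 1).choose (m + 1) := by simp [chooseSub]
    rw [image_empty, card_empty, show shadowSets v ∅ = ∅ from rfl, card_empty, Nat.sub_zero, h2,
      one_mul, Nat.choose_succ_succ']
    exact Nat.le_add_right _ _
  · rw [← smul_eq_mul]
    refine card_nsmul_le_sum _ _ _ fun x hx => ?_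
    have := card_shadowSets_singletons v {x}
    simp only [card_singleton] at this
    simp only [image_singleton, card_singleton, chooseSub] at this ⊢
    rw [if_pos (by omega), Nat.add_sub_cancel]
    exact Nat.choose_le_choose _ (by omega)

/-- The families `F` of sets of size at least three such that `F ∪ G` is an intersecting family
of size `s`, where `G` consists of pairs. -/
def extensions (n s : ℕ) (G : Finset (Finset ℕ)) : Finset (Finset (Finset ℕ)) :=
  (layerGE n 3).powerset.filter fun F =>
    #F + #G = s ∧ ∀ B ∈ F ∪ G, ∀ B' ∈ F ∪ G, (B ∩ B').Nonempty

theorem mem_extensions {n s : ℕ} {G F : Finset (Finset ℕ)} : F ∈ extensions n s G ↔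
    F ⊆ layerGE n 3 ∧ #F + #G = s ∧ ∀ B ∈ F ∪ G, ∀ B' ∈ F ∪ G, (B ∩ B').Nonempty := by
  rw [extensions, mem_filter, mem_powerset]

theorem mem_layerGE {n r : ℕ} {A : Finset ℕ} : A ∈ layerGE n r ↔ A ⊆ groundSet n ∧ r ≤ #A := by
  rw [layerGE, allFams, mem_filter, mem_powerset]

theorem mem_layerEQ {n r : ℕ} {A : Finset ℕ} : A ∈ layerEQ n r ↔ A ⊆ groundSet n ∧ #A = r := by
  rw [layerEQ, mem_powersetCard]

theorem disjoint_layerGE_three {n : ℕ} {𝓑 : Finset (Finset ℕ)} (h𝓑 : 𝓑 ⊆ layerEQ n 2) :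
    Disjoint (layerGE n 3) 𝓑 := by
  rw [Finset.disjoint_left]
  intro A hA hA'
  have h1 := (mem_layerGE.1 hA).2
  have h2 := (mem_layerEQ.1 (h𝓑 hA')).2
  omega

theorem card_interFams_eq_sum (n s : ℕ) {𝓑 : Finset (Finset ℕ)} (h𝓑 : 𝓑 ⊆ layerEQ n 2) :
    #(interFams s (layerGE n 3 ∪ 𝓑)) = ∑ G ∈ 𝓑.powerset, #(extensions n s G) := by
  have hd := disjoint_layerGE_three h𝓑
  rw [card_eq_sum_card_fiberwise (f := fun 𝓔 => 𝓔 ∩ 𝓑) (t := 𝓑.powerset)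
    fun 𝓔 _ => by simp]
  refine sum_congr rfl fun G hG => ?_
  have hG := mem_powerset.1 hG
  refine card_bij' (fun 𝓔 _ => 𝓔 \ 𝓑) (fun F _ => F ∪ G) ?_ ?_ ?_ ?_
  · intro 𝓔 h𝓔
    obtain ⟨h1, h2⟩ := mem_filter.1 h𝓔
    obtain ⟨h3, h4⟩ := mem_filter.1 h1
    obtain ⟨h5, h6⟩ := mem_powersetCard.1 h3
    have hU : 𝓔 \ 𝓑 ∪ G = 𝓔 := by rw [← h2, sdiff_union_inter]
    refine mem_extensions.2 ⟨?_, ?_, ?_⟩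
    · intro A hA
      obtain ⟨hA1, hA2⟩ := mem_sdiff.1 hA
      exact (mem_union.1 (h5 hA1)).resolve_right hA2
    · rw [← h6, ← h2, card_sdiff_add_card_inter]
    · rwa [hU]
  · intro F hF
    obtain ⟨h1, h2, h3⟩ := mem_extensions.1 hF
    have hFG : Disjoint F G := hd.mono h1 hG
    have hFB : Disjoint F 𝓑 := hd.mono_left h1
    refine mem_filter.2 ⟨mem_filter.2 ⟨mem_powersetCard.2 ⟨union_subset_union h1 hG, ?_⟩, h3⟩, ?_⟩
    · rw [card_union_of_disjoint hFG, h2]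
    · simp only [union_inter_distrib_right]
      rw [disjoint_iff_inter_eq_empty.1 hFB, empty_union, inter_eq_left.2 hG]
  · intro 𝓔 h𝓔
    obtain ⟨h1, h2⟩ := mem_filter.1 h𝓔
    rw [← h2, sdiff_union_inter]
  · intro F hF
    obtain ⟨h1, -, -⟩ := mem_extensions.1 hF
    have hFB : Disjoint F 𝓑 := hd.mono_left h1
    rw [union_sdiff_distrib, sdiff_eq_self_of_disjoint hFB, sdiff_eq_empty_iff_subset.2 hG,
      union_empty]

theorem card_extensions_le_image (n s : ℕ) (G : Finset (Finset ℕ)) (σ : Equiv.Perm ℕ)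
    (hσ : (groundSet n).image σ = groundSet n) :
    #(extensions n s G) ≤ #(extensions n s (G.image (image σ))) := by
  have hinj : Function.Injective (image σ : Finset ℕ → Finset ℕ) := image_injective σ.injective
  refine card_le_card_of_injOn (fun F => F.image (image σ)) ?_ (image_injective hinj).injOn
  intro F hF
  obtain ⟨h1, h2, h3⟩ := mem_extensions.1 hF
  refine mem_extensions.2 ⟨?_, ?_, ?_⟩
  · intro A hA
    obtain ⟨B, hB, rfl⟩ := mem_image.1 hA
    obtain ⟨h4, h5⟩ := mem_layerGE.1 (h1 hB)
    refine mem_layerGE.2 ⟨?_, ?_⟩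
    · rw [← hσ]; exact image_subset_image h4
    · rwa [card_image_of_injective _ σ.injective]
  · rw [card_image_of_injective _ hinj, card_image_of_injective _ hinj, h2]
  · rw [← image_union]
    intro A hA A' hA'
    obtain ⟨B, hB, rfl⟩ := mem_image.1 hA
    obtain ⟨B', hB', rfl⟩ := mem_image.1 hA'
    rw [← image_inter _ _ σ.injective]
    exact (h3 B hB B' hB').image _

theorem image_swap_groundSet {n a b : ℕ} (ha : a ∈ groundSet n) (hb : b ∈ groundSet n) :
    (groundSet n).image (Equiv.swap a b) = groundSet n := by
  refine eq_of_subset_of_card_le ?_ (by rw [card_image_of_injective _ (Equiv.injective _)])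
  intro x hx
  obtain ⟨y, hy, rfl⟩ := mem_image.1 hx
  rw [Equiv.swap_apply_def]
  split_ifs <;> assumption

theorem exists_perm_groundSet {n a b c a' b' c' : ℕ} (ha : a ∈ groundSet n) (hb : b ∈ groundSet n)
    (hc : c ∈ groundSet n) (ha' : a' ∈ groundSet n) (hb' : b' ∈ groundSet n)
    (hc' : c' ∈ groundSet n) (hab : a ≠ b) (hac : a ≠ c) (hbc : b ≠ c) (hab' : a' ≠ b')
    (hac' : a' ≠ c') (hbc' : b' ≠ c') : ∃ σ : Equiv.Perm ℕ,
      (groundSet n).image σ = groundSet n ∧ σ a = a' ∧ σ b = b' ∧ σ c = c' := by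
  have key : ∀ τ : Equiv.Perm ℕ, (groundSet n).image τ = groundSet n → ∀ x y, x ∈ groundSet n →
      y ∈ groundSet n → (groundSet n).image (τ.trans (Equiv.swap (τ x) y)) = groundSet n := by
    intro τ hτ x y hx hy
    rw [Equiv.coe_trans, ← image_image, hτ]
    exact image_swap_groundSet (by rw [← hτ]; exact mem_image_of_mem _ hx) hy
  have h1 := image_swap_groundSet ha ha'
  set τ₁ := Equiv.swap a a' with hτ₁
  have h1a : τ₁ a = a' := Equiv.swap_apply_left _ _
  have h2 := key τ₁ h1 b b' hb hb'
  set τ₂ := τ₁.trans (Equiv.swap (τ₁ b) b') with hτ₂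
  have h2b : τ₂ b = b' := by simp [hτ₂]
  have h2a : τ₂ a = a' := by
    rw [hτ₂, Equiv.trans_apply, h1a, Equiv.swap_apply_of_ne_of_ne _ hab']
    rw [← h1a]; exact fun h => hab (τ₁.injective h)
  have h3 := key τ₂ h2 c c' hc hc'
  refine ⟨_, h3, ?_, ?_, by simp⟩
  · rw [Equiv.trans_apply, h2a, Equiv.swap_apply_of_ne_of_ne _ hac']
    rw [← h2a]; exact fun h => hac (τ₂.injective h)
  · rw [Equiv.trans_apply, h2b, Equiv.swap_apply_of_ne_of_ne _ hbc']
    rw [← h2b]; exact fun h => hbc (τ₂.injective h)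

/-- The pairs `{c, x}` for `x ∈ L`. -/
def starPairs (c : ℕ) (L : Finset ℕ) : Finset (Finset ℕ) := L.image fun x => {c, x}

theorem starPairs_image (c : ℕ) (L : Finset ℕ) (σ : Equiv.Perm ℕ) :
    (starPairs c L).image (image σ) = starPairs (σ c) (L.image σ) := by
  ext A
  simp [starPairs, image_image, Function.comp_def, image_insert]

theorem card_starPairs {c : ℕ} {L : Finset ℕ} (hc : c ∉ L) : #(starPairs c L) = #L := by
  refine card_image_of_injOn fun x hx y hy h => ?_
  have hxc : x ≠ c := fun h => hc (h ▸ hx)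
  have : x ∈ ({c, y} : Finset ℕ) := by
    rw [← h]; simp
  simpa [hxc] using this

theorem card_extensions_starPairs_eq {n s a b c a' b' c' : ℕ} (ha : a ∈ groundSet n)
    (hb : b ∈ groundSet n) (hc : c ∈ groundSet n) (ha' : a' ∈ groundSet n) (hb' : b' ∈ groundSet n)
    (hc' : c' ∈ groundSet n) (hab : a ≠ b) (hac : a ≠ c) (hbc : b ≠ c) (hab' : a' ≠ b')
    (hac' : a' ≠ c') (hbc' : b' ≠ c') :
    #(extensions n s (starPairs c {a, b})) = #(extensions n s (starPairs c' {a', b'})) ∧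
      #(extensions n s {{c, a}}) = #(extensions n s {{c', a'}}) := by
  obtain ⟨σ, h1, rfl, rfl, rfl⟩ :=
    exists_perm_groundSet ha hb hc ha' hb' hc' hab hac hbc hab' hac' hbc'
  obtain ⟨τ, h2, h2a, h2b, h2c⟩ :=
    exists_perm_groundSet ha' hb' hc' ha hb hc hab' hac' hbc' hab hac hbc
  refine ⟨le_antisymm ?_ ?_, le_antisymm ?_ ?_⟩
  · simpa [starPairs_image, image_insert] using card_extensions_le_image n s (starPairs c {a, b}) σ h1
  · simpa [starPairs_image, image_insert, h2a, h2b, h2c] using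
      card_extensions_le_image n s (starPairs (σ c) {σ a, σ b}) τ h2
  · simpa [image_insert] using card_extensions_le_image n s {{c, a}} σ h1
  · simpa [image_insert, h2a, h2b, h2c] using card_extensions_le_image n s {{σ c, σ a}} τ h2

theorem mem_extensions_starPairs {n s c : ℕ} {L : Finset ℕ} (hcL : c ∉ L) (hL : L.Nonempty)
    {F : Finset (Finset ℕ)} : F ∈ extensions n s (starPairs c L) ↔
      F ⊆ layerGE n 3 ∧ #F + #L = s ∧ (∀ x ∈ F, c ∉ x → L ⊆ x) ∧
        ∀ x ∈ F, ∀ y ∈ F, c ∈ x → c ∉ y → (x ∩ y).Nonempty := by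
  rw [mem_extensions, card_starPairs hcL]
  refine and_congr_right fun hF => and_congr_right fun _ => ⟨fun h => ⟨?_, ?_⟩, ?_⟩
  · intro x hx hcx l hl
    obtain ⟨y, hy⟩ := h x (mem_union_left _ hx) {c, l}
      (mem_union_right _ (mem_image_of_mem _ hl))
    obtain ⟨hy1, hy2⟩ := mem_inter.1 hy
    rcases mem_insert.1 hy2 with rfl | hy2
    · exact absurd hy1 hcx
    · rwa [← mem_singleton.1 hy2]
  · exact fun x hx y hy _ _ => h x (mem_union_left _ hx) y (mem_union_left _ hy)
  · rintro ⟨h1, h2⟩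
    obtain ⟨l₀, hl₀⟩ := hL
    have hFs : ∀ x ∈ F, ∀ l ∈ L, (x ∩ {c, l}).Nonempty := by
      intro x hx l hl
      by_cases hcx : c ∈ x
      · exact ⟨c, by simp [hcx]⟩
      · exact ⟨l, by simp [h1 x hx hcx hl]⟩
    intro x hx y hy
    rcases mem_union.1 hx with hx | hx <;> rcases mem_union.1 hy with hy | hy
    · by_cases hcx : c ∈ x <;> by_cases hcy : c ∈ y
      · exact ⟨c, by simp [hcx, hcy]⟩
      · exact h2 x hx y hy hcx hcy
      · rw [inter_comm]; exact h2 y hy x hx hcy hcx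
      · exact ⟨l₀, mem_inter.2 ⟨h1 x hx hcx hl₀, h1 y hy hcy hl₀⟩⟩
    · obtain ⟨l, hl, rfl⟩ := mem_image.1 hy
      exact hFs x hx l hl
    · obtain ⟨l, hl, rfl⟩ := mem_image.1 hx
      rw [inter_comm]
      exact hFs y hy l hl
    · obtain ⟨l, hl, rfl⟩ := mem_image.1 hx
      obtain ⟨l', hl', rfl⟩ := mem_image.1 hy
      exact ⟨c, by simp⟩

/-- The sets of size at least three that contain `L` but not `c`. -/
def starOut (n c : ℕ) (L : Finset ℕ) : Finset (Finset ℕ) :=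
  (layerGE n 3).filter fun y => c ∉ y ∧ L ⊆ y

/-- The sets of size at least three that contain `c` and meet every member of `W`. -/
def starMeeting (n c : ℕ) (W : Finset (Finset ℕ)) : Finset (Finset ℕ) :=
  (layerGE n 3).filter fun x => c ∈ x ∧ ∀ y ∈ W, (x ∩ y).Nonempty

theorem card_extensions_starPairs {n s c : ℕ} {L : Finset ℕ} (hcL : c ∉ L) (hL : L.Nonempty) :
    #(extensions n s (starPairs c L)) =
      ∑ W ∈ (starOut n c L).powerset, chooseSub #(starMeeting n c W) s (#L + #W) := by
  rw [card_eq_sum_card_fiberwise (f := fun F => F.filter (c ∉ ·)) (t := (starOut n c L).powerset)]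
  swap
  · intro F hF
    obtain ⟨h1, -, h3, -⟩ := (mem_extensions_starPairs hcL hL).1 hF
    refine mem_powerset.2 fun y hy => ?_
    obtain ⟨hy1, hy2⟩ := mem_filter.1 hy
    exact mem_filter.2 ⟨h1 hy1, hy2, h3 y hy1 hy2⟩
  refine sum_congr rfl fun W hW => ?_
  have hW : ∀ y ∈ W, y ∈ layerGE n 3 ∧ c ∉ y ∧ L ⊆ y := fun y hy =>
    mem_filter.1 (mem_powerset.1 hW hy)
  have hsplit : ∀ F : Finset (Finset ℕ), #(F.filter (c ∈ ·)) + #(F.filter (c ∉ ·)) = #F :=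
    fun F => card_filter_add_card_filter_not _
  unfold chooseSub
  split_ifs with hs
  · rw [← card_powersetCard]
    refine card_bij' (fun F _ => F.filter (c ∈ ·)) (fun A _ => A ∪ W) ?_ ?_ ?_ ?_
    · intro F hF
      obtain ⟨hF1, rfl⟩ := mem_filter.1 hF
      obtain ⟨h1, h2, h3, h4⟩ := (mem_extensions_starPairs hcL hL).1 hF1
      refine mem_powersetCard.2 ⟨fun x hx => ?_, ?_⟩
      · obtain ⟨hx1, hx2⟩ := mem_filter.1 hx
        refine mem_filter.2 ⟨h1 hx1, hx2, fun y hy => ?_⟩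
        obtain ⟨hy1, hy2⟩ := mem_filter.1 hy
        exact h4 x hx1 y hy1 hx2 hy2
      · have := hsplit F
        omega
    · intro A hA
      obtain ⟨h1, h2⟩ := mem_powersetCard.1 hA
      have hA : ∀ x ∈ A, x ∈ layerGE n 3 ∧ c ∈ x ∧ ∀ y ∈ W, (x ∩ y).Nonempty := fun x hx =>
        mem_filter.1 (h1 hx)
      have hd : Disjoint A W := Finset.disjoint_left.2 fun x hx hx' => (hW x hx').2.1 (hA x hx).2.1
      refine mem_filter.2 ⟨(mem_extensions_starPairs hcL hL).2 ⟨?_, ?_, ?_, ?_⟩, ?_⟩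
      · exact union_subset (fun x hx => (hA x hx).1) fun x hx => (hW x hx).1
      · rw [card_union_of_disjoint hd]; omega
      · intro x hx hcx
        rcases mem_union.1 hx with hx | hx
        · exact absurd (hA x hx).2.1 hcx
        · exact (hW x hx).2.2
      · intro x hx y hy hcx hcy
        rcases mem_union.1 hx with hx | hx
        · rcases mem_union.1 hy with hy | hy
          · exact absurd (hA y hy).2.1 hcy
          · exact (hA x hx).2.2 y hy
        · exact absurd hcx (hW x hx).2.1
      · ext x
        simp only [mem_filter, mem_union]
        constructor
        · rintro ⟨hx | hx, hcx⟩
          · exact absurd (hA x hx).2.1 hcx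
          · exact hx
        · exact fun hx => ⟨Or.inr hx, (hW x hx).2.1⟩
    · intro F hF
      obtain ⟨hF1, rfl⟩ := mem_filter.1 hF
      exact filter_union_filter_not_eq _ _
    · intro A hA
      have hA : ∀ x ∈ A, x ∈ layerGE n 3 ∧ c ∈ x ∧ ∀ y ∈ W, (x ∩ y).Nonempty := fun x hx =>
        mem_filter.1 ((mem_powersetCard.1 hA).1 hx)
      ext x
      simp only [mem_filter, mem_union]
      constructor
      · rintro ⟨hx | hx, hcx⟩
        · exact hx
        · exact absurd hcx (hW x hx).2.1
      · exact fun hx => ⟨Or.inl hx, (hA x hx).2.1⟩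
  · rw [card_eq_zero, filter_eq_empty_iff]
    rintro F hF rfl
    obtain ⟨-, h2, -, -⟩ := (mem_extensions_starPairs hcL hL).1 hF
    have := hsplit F
    omega

theorem card_starMeeting_ge {n c v : ℕ} (hc : c ∈ groundSet n) (hv : v ∈ groundSet n)
    (hvc : v ≠ c) {W : Finset (Finset ℕ)} (hW : ∀ y ∈ W, v ∈ y) :
    2 ^ (n - 2) ≤ #(starMeeting n c W) + 1 := by
  set P := ((groundSet n).erase c).erase v
  have hP : #P = n - 2 := by
    rw [card_erase_of_mem (mem_erase.2 ⟨hvc, hv⟩), card_erase_of_mem hc, groundSet, Nat.card_Icc]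
    omega
  have hnot : ∀ S ⊆ P, c ∉ S ∧ v ∉ S := fun S hS =>
    ⟨fun h => by simpa [P] using hS h, fun h => by simpa [P] using hS h⟩
  have h1 : #(P.powerset.erase ∅) ≤ #(starMeeting n c W) := by
    refine card_le_card_of_injOn (fun S => insert c (insert v S)) ?_ ?_
    · intro S hS
      obtain ⟨hS1, hS2⟩ := mem_erase.1 hS
      have hS3 := mem_powerset.1 hS2
      obtain ⟨hcS, hvS⟩ := hnot S hS3
      refine mem_filter.2 ⟨mem_layerGE.2 ⟨?_, ?_⟩, by simp, fun y hy => ⟨v, ?_⟩⟩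
      · refine insert_subset hc (insert_subset hv (hS3.trans ?_))
        exact (erase_subset _ _).trans (erase_subset _ _)
      · rw [card_insert_of_notMem (by simp [hvc.symm, hcS]), card_insert_of_notMem hvS]
        have := card_pos.2 (nonempty_iff_ne_empty.2 hS1)
        omega
      · simp [hW y hy]
    · intro S hS S' hS' h
      obtain ⟨hcS, hvS⟩ := hnot S (mem_powerset.1 (mem_erase.1 hS).2)
      obtain ⟨hcS', hvS'⟩ := hnot S' (mem_powerset.1 (mem_erase.1 hS').2)
      have h2 : insert v S = insert v S' := by
        rw [← erase_insert (a := c) (s := insert v S) (by simp [hvc.symm, hcS]),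
          ← erase_insert (a := c) (s := insert v S') (by simp [hvc.symm, hcS'])]
        exact congrArg (fun A : Finset ℕ => A.erase c) h
      rw [← erase_insert hvS, h2, erase_insert hvS']
  rw [card_erase_of_mem (by simp), card_powerset, hP] at h1
  omega

theorem mul_card_extensions_starPairs_insert_le {n s c v ρ : ℕ} {L R : Finset ℕ}
    (hcL : c ∉ L) (hL : L.Nonempty) (hc : c ∈ groundSet n) (hv : v ∈ groundSet n)
    (hLn : L ⊆ groundSet n) (hvc : v ≠ c) (hvL : v ∉ L)
    (hR : R = groundSet n \ insert c (insert v L)) {𝒬 : Finset (Finset ℕ)}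
    (h𝒬 : ∀ S ∈ 𝒬, S ⊆ R ∧ 3 + #S ≤ #L + #R)
    (hρ : ∀ N m, 2 ^ (n - 2) ≤ N + 1 → ρ * N.choose m ≤ shadowSum v 𝒬 N (m + 1)) :
    ρ * #(extensions n s (starPairs c (insert v L))) ≤ #(extensions n s (starPairs c L)) := by
  have hcL' : c ∉ insert v L := by simp [hvc.symm, hcL]
  have hRmem : ∀ x, x ∈ R ↔ x ∈ groundSet n ∧ x ≠ c ∧ x ≠ v ∧ x ∉ L := by
    intro x; rw [hR]; simp only [mem_sdiff, mem_insert, not_or]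
  rw [card_extensions_starPairs hcL' (insert_nonempty _ _), card_extensions_starPairs hcL hL,
    card_insert_of_notMem hvL, mul_sum]
  set Y := starOut n c (insert v L)
  have hY : ∀ y ∈ Y, y ∈ layerGE n 3 ∧ c ∉ y ∧ insert v L ⊆ y := fun y hy => mem_filter.1 hy
  set z : Finset ℕ → Finset ℕ := fun S => L ∪ (R \ S)
  have hz : ∀ S ∈ 𝒬, z S ∈ starOut n c L ∧ v ∉ z S := by
    intro S hS
    obtain ⟨h1, h2⟩ := h𝒬 S hS
    refine ⟨mem_filter.2 ⟨mem_layerGE.2 ⟨?_, ?_⟩, ?_, subset_union_left⟩, ?_⟩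
    · refine union_subset hLn fun x hx => ((hRmem x).1 (mem_sdiff.1 hx).1).1
    · rw [card_union_of_disjoint, card_sdiff_of_subset h1]
      · omega
      · exact Finset.disjoint_left.2 fun x hx hx' =>
          ((hRmem x).1 (mem_sdiff.1 hx').1).2.2.2 hx
    · simp [z, hcL, hRmem]
    · simp [z, hvL, hRmem]
  have hzinj : Set.InjOn z 𝒬 := by
    have key : ∀ S ∈ 𝒬, R \ z S = S := by
      intro S hS
      ext x
      simp only [z, mem_sdiff, mem_union, not_or, not_and, not_not]
      constructor
      · exact fun h => h.2.2 h.1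
      · intro h
        have hx := (h𝒬 S hS).1 h
        exact ⟨hx, ((hRmem x).1 hx).2.2.2, fun _ => h⟩
    intro S hS S' hS' h
    rw [← key S hS, ← key S' hS', h]
  have hinj : Set.InjOn (fun p : Finset (Finset ℕ) × Finset (Finset ℕ) => p.1 ∪ p.2.image z)
      (Y.powerset ×ˢ 𝒬.powerset : Finset _) := by
    have key : ∀ p ∈ (Y.powerset ×ˢ 𝒬.powerset : Finset _),
        (p.1 ∪ p.2.image z).filter (v ∈ ·) = p.1 ∧
        (p.1 ∪ p.2.image z).filter (v ∉ ·) = p.2.image z := by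
      intro p hp
      obtain ⟨h1, h2⟩ := mem_product.1 hp
      have h1 : ∀ y ∈ p.1, v ∈ y := fun y hy =>
        (hY y (mem_powerset.1 h1 hy)).2.2 (mem_insert_self _ _)
      have h2 : ∀ y ∈ p.2.image z, v ∉ y := by
        intro y hy
        obtain ⟨S, hS, rfl⟩ := mem_image.1 hy
        exact (hz S (mem_powerset.1 h2 hS)).2
      constructor
      · rw [filter_union, filter_true_of_mem h1, filter_false_of_mem h2, union_empty]
      · rw [filter_union, filter_true_of_mem h2, filter_false_of_mem (by simpa using h1),
          empty_union]
    intro p hp p' hp' h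
    dsimp only at h
    obtain ⟨k1, k2⟩ := key p hp
    obtain ⟨k1', k2'⟩ := key p' hp'
    have e1 : p.1 = p'.1 := by rw [← k1, ← k1', h]
    have e2 : p.2.image z = p'.2.image z := by rw [← k2, ← k2', h]
    have m1 := mem_powerset.1 (mem_product.1 hp).2
    have m2 := mem_powerset.1 (mem_product.1 hp').2
    have e3 : p.2 = p'.2 := by
      ext S
      constructor
      · intro hS
        obtain ⟨S', hS', h'⟩ := mem_image.1 (e2 ▸ mem_image_of_mem z hS)
        rwa [← hzinj (m2 hS') (m1 hS) h']
      · intro hS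
        obtain ⟨S', hS', h'⟩ := mem_image.1 (e2.symm ▸ mem_image_of_mem z hS)
        rwa [← hzinj (m1 hS') (m2 hS) h']
    exact Prod.ext e1 e3
  have hcardp : ∀ W ⊆ Y, ∀ 𝒮 ⊆ 𝒬, #(W ∪ 𝒮.image z) = #W + #𝒮 := by
    intro W hW 𝒮 h𝒮
    rw [card_union_of_disjoint, card_image_of_injOn (hzinj.mono (by exact_mod_cast h𝒮))]
    refine Finset.disjoint_left.2 fun y hy hy' => ?_
    obtain ⟨S, hS, rfl⟩ := mem_image.1 hy'
    exact (hz S (h𝒮 hS)).2 ((hY _ (hW hy)).2.2 (mem_insert_self _ _))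
  have hmeet : ∀ W, ∀ 𝒮 ⊆ 𝒬, #(starMeeting n c W) - #(shadowSets v 𝒮)
      ≤ #(starMeeting n c (W ∪ 𝒮.image z)) := by
    intro W 𝒮 h𝒮
    rw [tsub_le_iff_right]
    have hsub : starMeeting n c W ⊆ starMeeting n c (W ∪ 𝒮.image z) ∪
        (shadowSets v 𝒮).image (insert c) := by
      intro x hx
      obtain ⟨h1, h2, h3⟩ := mem_filter.1 hx
      obtain ⟨h4, h5⟩ := mem_layerGE.1 h1
      by_cases hall : ∀ S ∈ 𝒮, (x ∩ z S).Nonempty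
      · refine mem_union_left _ (mem_filter.2 ⟨h1, h2, fun y hy => ?_⟩)
        rcases mem_union.1 hy with hy | hy
        · exact h3 y hy
        · obtain ⟨S, hS, rfl⟩ := mem_image.1 hy
          exact hall S hS
      · push Not at hall
        obtain ⟨S, hS, hS'⟩ := hall
        have hS' : ∀ y ∈ x, y ∉ z S := fun y hy hy' => by
          have : y ∈ x ∩ z S := mem_inter.2 ⟨hy, hy'⟩
          simp_all
        refine mem_union_right _ (mem_image.2 ⟨x.erase c, ?_, insert_erase h2⟩)
        refine mem_biUnion.2 ⟨S, hS, mem_filter.2 ⟨mem_powerset.2 fun y hy => ?_, ?_⟩⟩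
        · obtain ⟨hy1, hy2⟩ := mem_erase.1 hy
          have h6 := hS' y hy2
          simp only [z, mem_union, mem_sdiff, hRmem, not_or, not_and, not_not] at h6
          rw [mem_insert]
          by_contra! h7
          exact h7.2 (h6.2 ⟨h4 hy2, hy1, h7.1, h6.1⟩)
        · rw [card_erase_of_mem h2]; omega
    exact (card_le_card hsub).trans ((card_union_le _ _).trans
      (Nat.add_le_add_left card_image_le _))
  calc ∑ W ∈ Y.powerset, ρ * chooseSub #(starMeeting n c W) s (#L + 1 + #W)
      ≤ ∑ W ∈ Y.powerset, ∑ 𝒮 ∈ 𝒬.powerset,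
          chooseSub #(starMeeting n c (W ∪ 𝒮.image z)) s (#L + #(W ∪ 𝒮.image z)) := by
        refine sum_le_sum fun W hW => ?_
        have hW := mem_powerset.1 hW
        by_cases hs : #L + 1 + #W ≤ s
        · obtain ⟨m, rfl⟩ : ∃ m, s = m + (#L + 1 + #W) := ⟨s - (#L + 1 + #W), by omega⟩
          have h1 := hρ #(starMeeting n c W) m (card_starMeeting_ge hc hv hvc fun y hy =>
            (hY y (hW hy)).2.2 (mem_insert_self _ _))
          rw [chooseSub, if_pos hs, Nat.add_sub_cancel]
          refine h1.trans (sum_le_sum fun 𝒮 h𝒮 => ?_)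
          have h𝒮 := mem_powerset.1 h𝒮
          refine (chooseSub_mono (hmeet W 𝒮 h𝒮) _ _).trans (le_of_eq ?_)
          rw [hcardp W hW 𝒮 h𝒮]
          unfold chooseSub
          by_cases hm : #𝒮 ≤ m + 1
          · rw [if_pos hm, if_pos (by omega)]
            congr 1
            omega
          · rw [if_neg hm, if_neg (by omega)]
        · rw [chooseSub, if_neg hs, mul_zero]
          exact Nat.zero_le _
    _ = ∑ p ∈ Y.powerset ×ˢ 𝒬.powerset,
          chooseSub #(starMeeting n c (p.1 ∪ p.2.image z)) s (#L + #(p.1 ∪ p.2.image z)) :=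
        (sum_product (f := fun p : Finset (Finset ℕ) × Finset (Finset ℕ) =>
          chooseSub #(starMeeting n c (p.1 ∪ p.2.image z)) s (#L + #(p.1 ∪ p.2.image z))) ..).symm
    _ = ∑ V ∈ (Y.powerset ×ˢ 𝒬.powerset).image fun p => p.1 ∪ p.2.image z,
          chooseSub #(starMeeting n c V) s (#L + #V) := (sum_image (f := fun V =>
            chooseSub #(starMeeting n c V) s (#L + #V)) hinj).symm
    _ ≤ _ := by
        refine sum_le_sum_of_subset (image_subset_iff.2 fun p hp => mem_powerset.2 ?_)
        obtain ⟨h1, h2⟩ := mem_product.1 hp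
        refine union_subset (fun y hy => ?_) fun y hy => ?_
        · obtain ⟨h3, h4, h5⟩ := hY y (mem_powerset.1 h1 hy)
          exact mem_filter.2 ⟨h3, h4, (subset_insert _ _).trans h5⟩
        · obtain ⟨S, hS, rfl⟩ := mem_image.1 hy
          exact (hz S (mem_powerset.1 h2 hS)).1

theorem card_groundSet (n : ℕ) : #(groundSet n) = n := by simp [groundSet]

theorem card_groundSet_sdiff {n c v : ℕ} {L : Finset ℕ} (hcL : c ∉ L) (hc : c ∈ groundSet n)
    (hv : v ∈ groundSet n) (hLn : L ⊆ groundSet n) (hvc : v ≠ c) (hvL : v ∉ L) :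
    #(groundSet n \ insert c (insert v L)) + (#L + 2) = n := by
  have h1 := card_sdiff_add_card_eq_card (insert_subset hc (insert_subset hv hLn))
  rw [card_insert_of_notMem (by simp [hvc.symm, hcL]), card_insert_of_notMem hvL,
    card_groundSet] at h1
  omega

theorem card_extensions_star_three_le {n s c v : ℕ} {L : Finset ℕ} (hn : 21 ≤ n)
    (hcL : c ∉ L) (hL : #L = 2) (hc : c ∈ groundSet n) (hv : v ∈ groundSet n)
    (hLn : L ⊆ groundSet n) (hvc : v ≠ c) (hvL : v ∉ L) :
    14 * (n - 4).choose 4 * #(extensions n s (starPairs c (insert v L))) ≤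
      #(extensions n s (starPairs c L)) := by
  have hR := card_groundSet_sdiff hcL hc hv hLn hvc hvL
  set R := groundSet n \ insert c (insert v L) with hRdef
  have hRn : #R = n - 4 := by omega
  refine mul_card_extensions_starPairs_insert_le hcL (card_pos.1 (by omega)) hc hv hLn hvc hvL
    hRdef (𝒬 := insert ∅ (R.powerset.filter fun S => S.Nonempty ∧ #S ≤ 8)) ?_ ?_
  · intro S hS
    rcases mem_insert.1 hS with rfl | hS
    · simp; omega
    · obtain ⟨h1, -, h2⟩ := mem_filter.1 hS
      exact ⟨mem_powerset.1 h1, by omega⟩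
  · intro N m hN
    rw [← hRn]
    refine le_shadowSum_insert_empty_of_large v (by omega) ?_ (by simp) ?_
    · exact fun S hS h1 h2 => mem_filter.2 ⟨mem_powerset.2 hS, h1, h2⟩
    · rwa [show #R + 2 = n - 2 by omega]

theorem card_extensions_starPairs_insert_le {n s c v : ℕ} {L : Finset ℕ} (hn : 6 ≤ n)
    (hcL : c ∉ L) (hL : L.Nonempty) (hc : c ∈ groundSet n) (hv : v ∈ groundSet n)
    (hLn : L ⊆ groundSet n) (hvc : v ≠ c) (hvL : v ∉ L) :
    (n - 1 - #L) * #(extensions n s (starPairs c (insert v L))) ≤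
      #(extensions n s (starPairs c L)) := by
  have hR := card_groundSet_sdiff hcL hc hv hLn hvc hvL
  set R := groundSet n \ insert c (insert v L) with hRdef
  refine mul_card_extensions_starPairs_insert_le hcL hL hc hv hLn hvc hvL
    hRdef (𝒬 := insert ∅ (R.image singleton)) ?_ ?_
  · intro S hS
    rcases mem_insert.1 hS with rfl | hS
    · simp; omega
    · obtain ⟨x, hx, rfl⟩ := mem_image.1 hS
      exact ⟨by simpa using hx, by rw [card_singleton]; omega⟩
  · intro N m _
    rw [show n - 1 - #L = #R + 1 by omega]
    exact le_shadowSum_insert_empty_singletons v R N m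

theorem mul_card_extensions_starPairs_three_le {n s c : ℕ} {L : Finset ℕ} (hn : 21 ≤ n)
    (hc : c ∈ groundSet n) (hL : L ⊆ (groundSet n).erase c) (hL3 : #L = 3) :
    14 * (n - 4).choose 4 * #(extensions n s (starPairs c L)) ≤
      #(extensions n s (starPairs 1 {2, 3})) := by
  obtain ⟨a, b, v, hab, hav, hbv, rfl⟩ := card_eq_three.1 hL3
  have ha := mem_erase.1 (hL (show a ∈ ({a, b, v} : Finset ℕ) by simp))
  have hb := mem_erase.1 (hL (show b ∈ ({a, b, v} : Finset ℕ) by simp))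
  have hv := mem_erase.1 (hL (show v ∈ ({a, b, v} : Finset ℕ) by simp))
  have hg : ∀ x, 1 ≤ x → x ≤ n → x ∈ groundSet n := fun x h1 h2 => mem_Icc.2 ⟨h1, h2⟩
  rw [show ({a, b, v} : Finset ℕ) = insert v {a, b} by ext; simp; tauto]
  refine (card_extensions_star_three_le hn ?_ (card_pair hab) hc hv.2 ?_ hv.1 ?_).trans
    (card_extensions_starPairs_eq ha.2 hb.2 hc (hg 2 (by omega) (by omega))
      (hg 3 (by omega) (by omega)) (hg 1 (by omega) (by omega)) hab ha.1 hb.1 (by norm_num)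
      (by norm_num) (by norm_num)).1.le
  · simp [ha.1.symm, hb.1.symm]
  · simp [insert_subset_iff, ha.2, hb.2]
  · simp [hav.symm, hbv.symm]

theorem mul_card_extensions_starPairs_le {n s c : ℕ} (hn : 21 ≤ n) (hc : c ∈ groundSet n) (k : ℕ)
    {L : Finset ℕ} (hL : L ⊆ (groundSet n).erase c) (hLk : #L = k + 3) :
    4 ^ k * (14 * (n - 4).choose 4) * ((n - 1).choose (k + 3) *
      #(extensions n s (starPairs c L))) ≤
      (n - 1).choose 3 * #(extensions n s (starPairs 1 {2, 3})) := by
  induction k generalizing L with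
  | zero =>
    have := mul_card_extensions_starPairs_three_le (s := s) hn hc hL hLk
    calc _ = (n - 1).choose 3 * (14 * (n - 4).choose 4 * #(extensions n s (starPairs c L))) := by
          ring
      _ ≤ _ := Nat.mul_le_mul_left _ this
  | succ k ih =>
    obtain ⟨v, L, hvL, rfl, hL'⟩ := card_eq_succ.1 hLk
    have hv := mem_erase.1 (hL (mem_insert_self v L))
    have hLs := (subset_insert v L).trans hL
    have hstep := card_extensions_starPairs_insert_le (s := s) (by omega)
      (fun h => (mem_erase.1 (hLs h)).1 rfl) (card_pos.1 (by omega)) hc hv.2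
      (hLs.trans (erase_subset _ _)) hv.1 hvL
    refine le_trans ?_ (ih hLs hL')
    rw [hL'] at hstep
    have h1 := Nat.choose_succ_right_eq (n - 1) (k + 3)
    set f := #(extensions n s (starPairs c (insert v L)))
    set g := #(extensions n s (starPairs c L))
    have h2 : 4 * ((n - 1).choose (k + 3 + 1) * f) ≤ (n - 1).choose (k + 3) * g :=
      calc 4 * ((n - 1).choose (k + 3 + 1) * f)
          ≤ (k + 3 + 1) * ((n - 1).choose (k + 3 + 1) * f) := Nat.mul_le_mul_right _ (by omega)
        _ = (n - 1).choose (k + 3 + 1) * (k + 3 + 1) * f := by ring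
        _ = (n - 1).choose (k + 3) * ((n - 1 - (k + 3)) * f) := by rw [h1]; ring
        _ ≤ _ := Nat.mul_le_mul_left _ hstep
    rw [show k + 1 + 3 = k + 3 + 1 by ring]
    calc 4 ^ (k + 1) * (14 * (n - 4).choose 4) * ((n - 1).choose (k + 3 + 1) * f)
        = 4 ^ k * (14 * (n - 4).choose 4) * (4 * ((n - 1).choose (k + 3 + 1) * f)) := by ring
      _ ≤ _ := Nat.mul_le_mul_left _ h2

theorem three_mul_sum_le_of_geometric {a : ℕ → ℕ} {B K : ℕ} (h : ∀ k < K, 4 ^ k * a k ≤ B) :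
    3 * ∑ k ∈ range K, a k ≤ 4 * B := by
  suffices H : ∀ J ≤ K, 3 * (4 ^ J * ∑ k ∈ range J, a k) + 4 * B ≤ 4 * (4 ^ J * B) by
    have h1 := H K le_rfl
    have h2 : 4 ^ K * (3 * ∑ k ∈ range K, a k) ≤ 4 ^ K * (4 * B) := by linarith
    exact Nat.le_of_mul_le_mul_left h2 (by positivity)
  intro J
  induction J with
  | zero => simp
  | succ J ih =>
    intro hJ
    have h1 := ih (by omega)
    have h2 := h J hJ
    rw [sum_range_succ, pow_succ]
    linarith

theorem three_mul_sum_card_extensions_starPairs_le {n s c : ℕ} (hn : 21 ≤ n)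
    (hc : c ∈ groundSet n) :
    3 * (14 * (n - 4).choose 4 * ∑ L ∈ ((groundSet n).erase c).powerset.filter (3 ≤ #·),
      #(extensions n s (starPairs c L))) ≤
      4 * ((n - 1).choose 3 * #(extensions n s (starPairs 1 {2, 3}))) := by
  have hcard : #((groundSet n).erase c) = n - 1 := by
    rw [card_erase_of_mem hc, card_groundSet]
  rw [sum_filter, sum_powerset, hcard, show n - 1 + 1 = 3 + (n - 3) by omega, sum_range_add]
  rw [sum_eq_zero (s := range 3) fun j hj => sum_eq_zero fun L hL => if_neg (by
    have h1 := (mem_powersetCard.1 hL).2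
    have h2 := mem_range.1 hj
    omega), zero_add, mul_sum]
  refine three_mul_sum_le_of_geometric fun k hk => ?_
  have hpos : 0 < (n - 1).choose (k + 3) := Nat.choose_pos (by omega)
  refine Nat.le_of_mul_le_mul_left ?_ hpos
  set B := (n - 1).choose 3 * #(extensions n s (starPairs 1 {2, 3}))
  have hB : ∀ L ∈ ((groundSet n).erase c).powersetCard (3 + k),
      4 ^ k * (14 * (n - 4).choose 4) * ((n - 1).choose (k + 3) *
        (if 3 ≤ #L then #(extensions n s (starPairs c L)) else 0)) ≤ B := by
    intro L hL
    obtain ⟨h1, h2⟩ := mem_powersetCard.1 hL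
    rw [if_pos (by omega)]
    exact mul_card_extensions_starPairs_le hn hc k h1 (by omega)
  have hsum := sum_le_card_nsmul _ _ _ hB
  rw [card_powersetCard, hcard, smul_eq_mul, ← mul_sum, ← mul_sum, add_comm 3 k] at hsum
  refine le_trans (le_of_eq ?_) hsum
  rw [add_comm 3 k]
  ring

/-- A maximal intersecting family of sets of size at least three all of whose members meet every
pair `{c, x}`, `x ∈ L`. -/
def starKernel (n c : ℕ) (L : Finset ℕ) : Finset (Finset ℕ) :=
  (layerGE n 3).filter fun x => (c ∈ x ∧ (x ∩ L).Nonempty) ∨ (c ∉ x ∧ L ⊆ x)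

theorem choose_card_starKernel_le {n s c : ℕ} {L : Finset ℕ} (hcL : c ∉ L) (hL : L.Nonempty)
    (hs : #L ≤ s) : (#(starKernel n c L)).choose (s - #L) ≤ #(extensions n s (starPairs c L)) := by
  rw [← card_powersetCard]
  refine card_le_card fun F hF => ?_
  obtain ⟨h1, h2⟩ := mem_powersetCard.1 hF
  have h1 : ∀ x ∈ F, x ∈ layerGE n 3 ∧ ((c ∈ x ∧ (x ∩ L).Nonempty) ∨ (c ∉ x ∧ L ⊆ x)) :=
    fun x hx => mem_filter.1 (h1 hx)
  refine (mem_extensions_starPairs hcL hL).2 ⟨fun x hx => (h1 x hx).1, by omega, ?_, ?_⟩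
  · intro x hx hcx
    have := (h1 x hx).2
    tauto
  · intro x hx y hy hcx hcy
    have h3 : (x ∩ L).Nonempty := by have := (h1 x hx).2; tauto
    have h4 : L ⊆ y := by have := (h1 y hy).2; tauto
    exact h3.mono (inter_subset_inter_left h4)

theorem card_starKernel_ge {n c : ℕ} {L : Finset ℕ} (hc : c ∈ groundSet n)
    (hL : L ⊆ (groundSet n).erase c) (hL3 : 3 ≤ #L) : 2 ^ (n - 1) ≤ #(starKernel n c L) + #L := by
  set P := (groundSet n).erase c with hP
  have hPc : #P = n - 1 := by rw [card_erase_of_mem hc, card_groundSet]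
  have hcP : c ∉ P := by simp [hP]
  have hPn : P ⊆ groundSet n := erase_subset _ _
  let ψ : Finset ℕ → Finset ℕ := fun S => if (S ∩ L).Nonempty then insert c S else P \ S
  have hψ : Set.InjOn ψ P.powerset := by
    intro S hS S' hS' h
    have hS := mem_powerset.1 hS
    have hS' := mem_powerset.1 hS'
    have hcS : c ∉ S := fun h => hcP (hS h)
    have hcS' : c ∉ S' := fun h => hcP (hS' h)
    simp only [ψ] at h
    split_ifs at h with h1 h2 h2
    · rw [← erase_insert hcS, h, erase_insert hcS']
    · exact absurd (h ▸ mem_insert_self c S) (by simp [hcP])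
    · exact absurd (h ▸ mem_insert_self c S') (by simp [hcP])
    · rw [← Finset.sdiff_sdiff_eq_self hS, h, Finset.sdiff_sdiff_eq_self hS']
  have hsub : P.powerset.image ψ ⊆ starKernel n c L ∪ starPairs c L := by
    intro x hx
    obtain ⟨S, hS, rfl⟩ := mem_image.1 hx
    have hS := mem_powerset.1 hS
    have hcS : c ∉ S := fun h => hcP (hS h)
    simp only [ψ]
    split_ifs with h1
    · by_cases h2 : 2 ≤ #S
      · refine mem_union_left _ (mem_filter.2 ⟨mem_layerGE.2 ⟨insert_subset hc (hS.trans hPn), ?_⟩,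
          Or.inl ⟨mem_insert_self _ _, ?_⟩⟩)
        · rw [card_insert_of_notMem hcS]; omega
        · exact h1.mono (inter_subset_inter_right (subset_insert _ _))
      · obtain ⟨l, hl⟩ := h1
        obtain ⟨hl1, hl2⟩ := mem_inter.1 hl
        have : S = {l} := (eq_of_subset_of_card_le (singleton_subset_iff.2 hl1)
          (by rw [card_singleton]; omega)).symm
        exact mem_union_right _ (mem_image.2 ⟨l, hl2, by rw [this]⟩)
    · have h2 : L ⊆ P \ S := fun l hl => mem_sdiff.2 ⟨hL hl, fun h => h1 ⟨l, mem_inter.2 ⟨h, hl⟩⟩⟩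
      refine mem_union_left _ (mem_filter.2 ⟨mem_layerGE.2 ⟨sdiff_subset.trans hPn, ?_⟩,
        Or.inr ⟨?_, h2⟩⟩)
      · exact hL3.trans (card_le_card h2)
      · simp [hcP]
  have h1 := card_le_card hsub
  rw [card_image_of_injOn hψ, card_powerset, hPc] at h1
  refine h1.trans ((card_union_le _ _).trans (Nat.add_le_add_left card_image_le _))

theorem card_extensions_pair_pos {n s : ℕ} (hn : 21 ≤ n) (hs1 : 2 ≤ s) (hs2 : s ≤ 2 ^ (n - 1)) :
    0 < #(extensions n s (starPairs 1 {2, 3})) := by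
  rcases hs1.eq_or_lt with rfl | hs3
  · refine card_pos.2 ⟨∅, (mem_extensions_starPairs (by simp) (by simp)).2 ?_⟩
    simp
  · have hg : ∀ x, 1 ≤ x → x ≤ n → x ∈ groundSet n := fun x h1 h2 => mem_Icc.2 ⟨h1, h2⟩
    have h1 : 1 ∈ groundSet n := hg 1 (by omega) (by omega)
    have hL : ({2, 3, 4} : Finset ℕ) ⊆ (groundSet n).erase 1 := by
      intro x hx
      simp only [mem_insert, mem_singleton] at hx
      exact mem_erase.2 ⟨by omega, hg x (by omega) (by omega)⟩
    have hL3 : #({2, 3, 4} : Finset ℕ) = 3 := by decide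
    refine lt_of_lt_of_le ?_ (mul_card_extensions_starPairs_three_le (s := s) hn h1 hL hL3)
    have h2 := card_starKernel_ge h1 hL hL3.ge
    have h3 := choose_card_starKernel_le (n := n) (s := s) (c := 1) (L := {2, 3, 4}) (by simp)
      (by simp) (by omega)
    have h4 : 0 < (#(starKernel n 1 {2, 3, 4})).choose (s - #({2, 3, 4} : Finset ℕ)) :=
      Nat.choose_pos (by omega)
    have h5 : 0 < (n - 4).choose 4 := Nat.choose_pos (by omega)
    have h6 := h4.trans_le h3
    positivity

theorem card_extensions_triangle_le {n s a b c d : ℕ} (hab : a ≠ b) (hac : a ≠ c) (hbc : b ≠ c)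
    (hda : d ≠ a) (hdb : d ≠ b) (hdc : d ≠ c) (hc : c ∈ groundSet n) (hd : d ∈ groundSet n) :
    #(extensions n s (({a, b, c} : Finset ℕ).powersetCard 2)) ≤
      #(extensions n s (starPairs c {a, b, d})) := by
  have hT : #({a, b, c} : Finset ℕ) = 3 := card_eq_three.2 ⟨a, b, c, hab, hac, hbc, rfl⟩
  have hL : #({a, b, d} : Finset ℕ) = 3 := card_eq_three.2 ⟨a, b, d, hab, hda.symm, hdb.symm, rfl⟩
  have hcL : c ∉ ({a, b, d} : Finset ℕ) := by simp [hac.symm, hbc.symm, hdc.symm]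
  have hG : #(({a, b, c} : Finset ℕ).powersetCard 2) = 3 := by
    rw [card_powersetCard, hT]; rfl
  rcases Nat.lt_or_ge s 3 with hs | hs
  · refine (card_eq_zero.2 (eq_empty_of_forall_notMem fun F hF => ?_)).trans_le (Nat.zero_le _)
    have := (mem_extensions.1 hF).2.1
    omega
  set M := (layerGE n 3).filter fun x =>
    (a ∈ x ∨ b ∈ x) ∧ (a ∈ x ∨ c ∈ x) ∧ (b ∈ x ∨ c ∈ x) with hM
  set Q := starKernel n c {a, b, d} with hQ
  have hMQ : #M ≤ #Q := by
    have hMQ' : ∀ x ∈ M \ Q, x ∈ layerGE n 3 ∧ c ∉ x ∧ a ∈ x ∧ b ∈ x ∧ d ∉ x := by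
      intro x hx
      obtain ⟨h1, h2⟩ := mem_sdiff.1 hx
      obtain ⟨h3, h4⟩ := mem_filter.1 h1
      have h5 : ¬ ((c ∈ x ∧ (x ∩ {a, b, d}).Nonempty) ∨ (c ∉ x ∧ ({a, b, d} : Finset ℕ) ⊆ x)) :=
        fun h => h2 (mem_filter.2 ⟨h3, h⟩)
      have hcx : c ∉ x := by
        intro hcx
        refine h5 (Or.inl ⟨hcx, ?_⟩)
        rcases h4.1 with h | h
        · exact ⟨a, by simp [h]⟩
        · exact ⟨b, by simp [h]⟩
      refine ⟨h3, hcx, by tauto, by tauto, fun hdx => h5 (Or.inr ⟨hcx, ?_⟩)⟩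
      have : a ∈ x := by tauto
      have : b ∈ x := by tauto
      simp [insert_subset_iff, *]
    have hle : #(M \ Q) ≤ #(Q \ M) := by
      refine card_le_card_of_injOn (fun x => insert c (insert d ((x.erase a).erase b))) ?_ ?_
      · intro x hx
        obtain ⟨h1, h2, h3, h4, h5⟩ := hMQ' x hx
        obtain ⟨h6, h7⟩ := mem_layerGE.1 h1
        refine mem_sdiff.2 ⟨mem_filter.2 ⟨mem_layerGE.2 ⟨?_, ?_⟩, Or.inl ⟨by simp, d, by simp⟩⟩, ?_⟩
        · exact insert_subset hc (insert_subset hd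
            ((erase_subset _ _).trans ((erase_subset _ _).trans h6)))
        · rw [card_insert_of_notMem (by simp [hdc.symm, h2]), card_insert_of_notMem (by simp [h5]),
            card_erase_of_mem (by simp [hab.symm, h4]), card_erase_of_mem h3]
          omega
        · intro h
          have := (mem_filter.1 h).2.1
          simp [hac, hbc, hda.symm, hdb.symm] at this
      · intro x hx y hy h
        obtain ⟨-, h2, h3, h4, h5⟩ := hMQ' x hx
        obtain ⟨-, h2', h3', h4', h5'⟩ := hMQ' y hy
        have h6 : ∀ u, u ∈ insert c (insert d ((x.erase a).erase b)) ↔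
            u ∈ insert c (insert d ((y.erase a).erase b)) := fun u => by
          dsimp only at h; rw [h]
        ext u
        have h7 := h6 u
        simp only [mem_insert, mem_erase] at h7
        by_cases e1 : u = a
        · simp [e1, h3, h3']
        by_cases e2 : u = b
        · simp [e2, h4, h4']
        by_cases e3 : u = c
        · simp [e3, h2, h2']
        by_cases e4 : u = d
        · simp [e4, h5, h5']
        simpa [e1, e2, e3, e4] using h7
    have h1 := card_sdiff_add_card_inter M Q
    have h2 := card_sdiff_add_card_inter Q M
    rw [inter_comm] at h2
    omega
  have h1 : #(extensions n s (({a, b, c} : Finset ℕ).powersetCard 2)) ≤ (#M).choose (s - 3) := by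
    rw [← card_powersetCard]
    refine card_le_card fun F hF => ?_
    obtain ⟨h1, h2, h3⟩ := mem_extensions.1 hF
    refine mem_powersetCard.2 ⟨fun x hx => mem_filter.2 ⟨h1 hx, ?_⟩, by omega⟩
    have key : ∀ u v, u ≠ v → ({u, v} : Finset ℕ) ⊆ {a, b, c} → u ∈ x ∨ v ∈ x := by
      intro u v huv hsub
      obtain ⟨y, hy⟩ := h3 x (mem_union_left _ hx) {u, v}
        (mem_union_right _ (mem_powersetCard.2 ⟨hsub, card_pair huv⟩))
      simp only [mem_inter, mem_insert, mem_singleton] at hy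
      rcases hy with ⟨hy, rfl | rfl⟩
      · exact Or.inl hy
      · exact Or.inr hy
    exact ⟨key a b hab (by simp [insert_subset_iff]), key a c hac (by simp [insert_subset_iff]),
      key b c hbc (by simp)⟩
  have h2 := choose_card_starKernel_le (n := n) (s := s) hcL (card_pos.1 (by omega)) (by omega)
  rw [hL] at h2
  exact h1.trans ((Nat.choose_le_choose _ hMQ).trans h2)

theorem mul_card_extensions_triangle_le {n s : ℕ} (hn : 21 ≤ n) {T : Finset ℕ}
    (hT : T ∈ (groundSet n).powersetCard 3) :
    14 * (n - 4).choose 4 * #(extensions n s (T.powersetCard 2)) ≤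
      #(extensions n s (starPairs 1 {2, 3})) := by
  obtain ⟨hTn, hT3⟩ := mem_powersetCard.1 hT
  obtain ⟨d, hd, hdT⟩ : ∃ d ∈ groundSet n, d ∉ T :=
    exists_mem_notMem_of_card_lt_card (by rw [card_groundSet]; omega)
  obtain ⟨a, b, c, hab, hac, hbc, rfl⟩ := card_eq_three.1 hT3
  simp only [mem_insert, mem_singleton, not_or] at hdT
  have hTn : a ∈ groundSet n ∧ b ∈ groundSet n ∧ c ∈ groundSet n := by
    simpa [insert_subset_iff] using hTn
  have h1 := card_extensions_triangle_le (s := s) hab hac hbc hdT.1 hdT.2.1 hdT.2.2 hTn.2.2 hd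
  refine (Nat.mul_le_mul_left _ h1).trans
    (mul_card_extensions_starPairs_three_le hn hTn.2.2 ?_ ?_)
  · intro x hx
    simp only [mem_insert, mem_singleton] at hx
    rcases hx with rfl | rfl | rfl
    · exact mem_erase.2 ⟨hac, hTn.1⟩
    · exact mem_erase.2 ⟨hbc, hTn.2.1⟩
    · exact mem_erase.2 ⟨hdT.2.2, hd⟩
  · exact card_eq_three.2 ⟨a, b, d, hab, Ne.symm hdT.1, Ne.symm hdT.2.1, rfl⟩

theorem exists_starPairs_or_triangle {n : ℕ} {G : Finset (Finset ℕ)} (hG : G ⊆ layerEQ n 2)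
    (hI : ∀ A ∈ G, ∀ B ∈ G, (A ∩ B).Nonempty) (h3 : 3 ≤ #G) :
    (∃ c ∈ groundSet n, ∃ L ⊆ (groundSet n).erase c, 3 ≤ #L ∧ G = starPairs c L) ∨
      ∃ T ∈ (groundSet n).powersetCard 3, G = T.powersetCard 2 := by
  have hpair : ∀ A ∈ G, ∀ c ∈ A, ∃ x, x ≠ c ∧ A = {c, x} := by
    intro A hA c hc
    have h := (mem_powersetCard.1 (hG hA)).2
    obtain ⟨x, hx⟩ := card_eq_one.1 (show #(A.erase c) = 1 by rw [card_erase_of_mem hc, h])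
    refine ⟨x, (mem_erase.1 (hx ▸ mem_singleton_self x : x ∈ A.erase c)).1, ?_⟩
    rw [← hx, insert_erase hc]
  have hsub : ∀ A ∈ G, A ⊆ groundSet n := fun A hA => (mem_powersetCard.1 (hG hA)).1
  obtain ⟨A, hA, B, hB, hAB⟩ := one_lt_card.1 (show 1 < #G by omega)
  obtain ⟨c, hc⟩ := hI A hA B hB
  obtain ⟨hcA, hcB⟩ := mem_inter.1 hc
  by_cases hall : ∀ D ∈ G, c ∈ D
  · left
    have hGL : G = starPairs c (((groundSet n).erase c).filter fun x => {c, x} ∈ G) := by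
      ext D
      simp only [starPairs, mem_image, mem_filter]
      constructor
      · intro hD
        obtain ⟨x, hxc, rfl⟩ := hpair D hD c (hall D hD)
        exact ⟨x, ⟨mem_erase.2 ⟨hxc, hsub _ hD (by simp)⟩, hD⟩, rfl⟩
      · rintro ⟨x, ⟨-, hx⟩, rfl⟩
        exact hx
    refine ⟨c, hsub A hA hcA, _, filter_subset _ _, ?_, hGL⟩
    rw [← card_starPairs (c := c) (by simp), ← hGL]
    exact h3
  · right
    push Not at hall
    obtain ⟨D, hD, hcD⟩ := hall
    obtain ⟨a, hac, rfl⟩ := hpair A hA c hcA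
    obtain ⟨b, hbc, rfl⟩ := hpair B hB c hcB
    have hab : a ≠ b := fun h => hAB (by rw [h])
    have hmem : ∀ u, ∀ E ∈ G, {c, u} ∈ G → c ∉ E → u ∈ E := by
      intro u E hE hu hcE
      obtain ⟨y, hy⟩ := hI _ hu _ hE
      simp only [mem_inter, mem_insert, mem_singleton] at hy
      rcases hy with ⟨rfl | rfl, hy⟩
      · exact absurd hy hcE
      · exact hy
    have haD := hmem a D hD hA hcD
    have hbD := hmem b D hD hB hcD
    have hDeq : ({a, b} : Finset ℕ) = D :=
      eq_of_subset_of_card_le (by simp [insert_subset_iff, haD, hbD])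
        (by rw [(mem_powersetCard.1 (hG hD)).2, card_pair hab])
    have hT3 : #({a, b, c} : Finset ℕ) = 3 := card_eq_three.2 ⟨a, b, c, hab, hac, hbc, rfl⟩
    refine ⟨{a, b, c}, mem_powersetCard.2 ⟨?_, hT3⟩, ?_⟩
    · simp only [insert_subset_iff, singleton_subset_iff]
      exact ⟨hsub D hD haD, hsub D hD hbD, hsub _ hA hcA⟩
    · refine eq_of_subset_of_card_le (fun E hE => mem_powersetCard.2 ⟨?_,
        (mem_powersetCard.1 (hG hE)).2⟩) (by rw [card_powersetCard, hT3]; exact h3)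
      by_cases hcE : c ∈ E
      · obtain ⟨x, hxc, rfl⟩ := hpair E hE c hcE
        obtain ⟨y, hy⟩ := hI _ hE _ hD
        rw [← hDeq] at hy
        simp only [mem_inter, mem_insert, mem_singleton] at hy
        intro z hz
        simp only [mem_insert, mem_singleton] at hz ⊢
        grind
      · have h1 := hmem a E hE hA hcE
        have h2 := hmem b E hE hB hcE
        have h4 : ({a, b} : Finset ℕ) = E :=
          eq_of_subset_of_card_le (by simp [insert_subset_iff, h1, h2])
            (by rw [(mem_powersetCard.1 (hG hE)).2, card_pair hab])
        rw [← h4]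
        simp [insert_subset_iff]

theorem card_extensions_eq_zero {n s : ℕ} {G : Finset (Finset ℕ)}
    (hI : ¬ ∀ A ∈ G, ∀ B ∈ G, (A ∩ B).Nonempty) : #(extensions n s G) = 0 := by
  refine card_eq_zero.2 (eq_empty_of_forall_notMem fun F hF => hI fun A hA B hB => ?_)
  exact (mem_extensions.1 hF).2.2 A (mem_union_right _ hA) B (mem_union_right _ hB)

theorem card_extensions_of_card_eq_one {n s : ℕ} (hn : 21 ≤ n) {G : Finset (Finset ℕ)}
    (hG : G ⊆ layerEQ n 2) (h1 : #G = 1) : #(extensions n s G) = #(extensions n s {{1, 2}}) := by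
  have hg : ∀ x, 1 ≤ x → x ≤ 21 → x ∈ groundSet n := fun x h1 h2 =>
    Finset.mem_Icc.2 ⟨h1, h2.trans hn⟩
  obtain ⟨A, rfl⟩ := card_eq_one.1 h1
  obtain ⟨hAn, hA2⟩ := mem_powersetCard.1 (singleton_subset_iff.1 hG)
  obtain ⟨b, hb, hbA⟩ : ∃ b ∈ groundSet n, b ∉ A :=
    exists_mem_notMem_of_card_lt_card (by rw [card_groundSet]; omega)
  obtain ⟨c, a, hca, rfl⟩ := card_eq_two.1 hA2
  simp only [mem_insert, mem_singleton, not_or] at hbA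
  exact (card_extensions_starPairs_eq (hAn (by simp)) hb (hAn (by simp))
    (hg 2 (by norm_num) (by norm_num)) (hg 3 (by norm_num) (by norm_num))
    (hg 1 (by norm_num) (by norm_num)) (Ne.symm hbA.2) hca.symm hbA.1
    (by norm_num) (by norm_num) (by norm_num)).2

theorem card_extensions_of_card_eq_two {n s : ℕ} (hn : 21 ≤ n) {G : Finset (Finset ℕ)}
    (hG : G ⊆ layerEQ n 2) (h2 : #G = 2) (hI : ∀ A ∈ G, ∀ B ∈ G, (A ∩ B).Nonempty) :
    #(extensions n s G) = #(extensions n s (starPairs 1 {2, 3})) := by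
  have hg : ∀ x, 1 ≤ x → x ≤ 21 → x ∈ groundSet n := fun x h1 h2 =>
    Finset.mem_Icc.2 ⟨h1, h2.trans hn⟩
  obtain ⟨A, B, hAB, rfl⟩ := card_eq_two.1 h2
  obtain ⟨hAn, hA2⟩ := mem_powersetCard.1 (hG (mem_insert_self A {B}))
  obtain ⟨hBn, hB2⟩ := mem_powersetCard.1 (hG (show B ∈ {A, B} by simp))
  obtain ⟨c, hc⟩ := hI A (by simp) B (by simp)
  obtain ⟨hcA, hcB⟩ := mem_inter.1 hc
  obtain ⟨a, ha⟩ := card_eq_one.1 (show #(A.erase c) = 1 by rw [card_erase_of_mem hcA, hA2])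
  obtain ⟨b, hb⟩ := card_eq_one.1 (show #(B.erase c) = 1 by rw [card_erase_of_mem hcB, hB2])
  have hac := mem_erase.1 (ha ▸ mem_singleton_self a : a ∈ A.erase c)
  have hbc := mem_erase.1 (hb ▸ mem_singleton_self b : b ∈ B.erase c)
  have hA : A = {c, a} := by rw [← ha, insert_erase hcA]
  have hB : B = {c, b} := by rw [← hb, insert_erase hcB]
  have hst : ({A, B} : Finset (Finset ℕ)) = starPairs c {a, b} := by
    rw [starPairs, image_insert, image_singleton, ← hA, ← hB]
  rw [hst]
  exact (card_extensions_starPairs_eq (hAn hac.2) (hBn hbc.2) (hAn hcA)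
    (hg 2 (by norm_num) (by norm_num)) (hg 3 (by norm_num) (by norm_num))
    (hg 1 (by norm_num) (by norm_num)) (fun h => hAB (by rw [hA, hB, h])) hac.1 hbc.1
    (by norm_num) (by norm_num) (by norm_num)).1

theorem sum_card_extensions_three_le (n s : ℕ) {𝓑 : Finset (Finset ℕ)} (h𝓑 : 𝓑 ⊆ layerEQ n 2) :
    ∑ G ∈ 𝓑.powerset with 3 ≤ #G, #(extensions n s G) ≤
      (∑ c ∈ groundSet n, ∑ L ∈ ((groundSet n).erase c).powerset.filter (3 ≤ #·),
        #(extensions n s (starPairs c L))) +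
      ∑ T ∈ (groundSet n).powersetCard 3, #(extensions n s (T.powersetCard 2)) := by
  classical
  set S := ((groundSet n).sigma fun c => ((groundSet n).erase c).powerset.filter (3 ≤ #·)).image
    fun p => starPairs p.1 p.2 with hS
  set U := ((groundSet n).powersetCard 3).image fun T => T.powersetCard 2 with hU
  have h1 : ∑ G ∈ 𝓑.powerset with 3 ≤ #G, #(extensions n s G) ≤
      ∑ G ∈ S ∪ U, #(extensions n s G) := by
    refine sum_le_sum_of_ne_zero fun G hG h0 => ?_
    obtain ⟨hG1, hG2⟩ := mem_filter.1 hG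
    have hI : ∀ A ∈ G, ∀ B ∈ G, (A ∩ B).Nonempty := by
      by_contra h
      exact h0 (card_extensions_eq_zero h)
    rcases exists_starPairs_or_triangle ((mem_powerset.1 hG1).trans h𝓑) hI hG2 with
      ⟨c, hc, L, hL, hL3, rfl⟩ | ⟨T, hT, rfl⟩
    · exact mem_union_left _ (mem_image.2 ⟨⟨c, L⟩, mem_sigma.2 ⟨hc,
        mem_filter.2 ⟨mem_powerset.2 hL, hL3⟩⟩, rfl⟩)
    · exact mem_union_right _ (mem_image_of_mem _ hT)
  refine h1.trans ?_
  have h2 : ∑ G ∈ S ∪ U, #(extensions n s G) ≤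
      ∑ G ∈ S, #(extensions n s G) + ∑ G ∈ U, #(extensions n s G) := by
    rw [← sum_union_inter]; exact Nat.le_add_right _ _
  refine h2.trans (Nat.add_le_add ?_ ?_)
  · rw [sum_sigma']
    exact sum_image_le_of_nonneg (fun _ _ => Nat.zero_le _)
  · exact sum_image_le_of_nonneg (fun _ _ => Nat.zero_le _)

theorem choose_four_lt {n : ℕ} (hn : 21 ≤ n) :
    4 * (n * (n - 1).choose 3) + 3 * n.choose 3 < 42 * (n - 4).choose 4 := by
  obtain ⟨k, rfl⟩ := Nat.exists_eq_add_of_le hn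
  have h1 := Nat.descFactorial_eq_factorial_mul_choose (k + 20) 3
  have h2 := Nat.descFactorial_eq_factorial_mul_choose (k + 21) 3
  have h3 := Nat.descFactorial_eq_factorial_mul_choose (k + 17) 4
  simp only [Nat.descFactorial_succ, Nat.descFactorial_zero, Nat.factorial, mul_one,
    Nat.add_sub_assoc, Nat.reduceLeDiff, Nat.reduceSub, Nat.succ_eq_add_one, Nat.reduceAdd,
    Nat.reduceMul, Nat.sub_zero] at h1 h2 h3
  have e1 : 21 + k - 1 = k + 20 := by omega
  have e2 : 21 + k - 4 = k + 17 := by omega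
  rw [e1, e2, add_comm 21 k]
  generalize (k + 20).choose 3 = x at *
  generalize (k + 21).choose 3 = y at *
  generalize (k + 17).choose 4 = z at *
  have h4 : 6 * ((k + 21) * x) = (k + 21) * ((k + 18) * ((k + 19) * (k + 20))) := by
    rw [h1]; ring
  ring_nf at h2 h3 h4 ⊢
  nlinarith [Nat.zero_le k, Nat.zero_le (k ^ 2), Nat.zero_le (k ^ 3), Nat.zero_le (k ^ 4)]

theorem sum_card_extensions_three_lt {n s : ℕ} (hn : 21 ≤ n) (hs1 : 2 ≤ s)
    (hs2 : s ≤ 2 ^ (n - 1)) {𝓑 : Finset (Finset ℕ)} (h𝓑 : 𝓑 ⊆ layerEQ n 2) :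
    ∑ G ∈ 𝓑.powerset with 3 ≤ #G, #(extensions n s G) <
      #(extensions n s (starPairs 1 {2, 3})) := by
  have h0 := card_extensions_pair_pos hn hs1 hs2
  have h1 := sum_card_extensions_three_le n s h𝓑
  have h2 := sum_le_sum fun c hc =>
    three_mul_sum_card_extensions_starPairs_le (s := s) hn (c := c) hc
  have h3 := sum_le_sum fun T hT => mul_card_extensions_triangle_le (n := n) (s := s) hn (T := T) hT
  rw [← mul_sum, ← mul_sum, sum_const, card_groundSet, smul_eq_mul] at h2
  rw [← mul_sum, sum_const, card_powersetCard, card_groundSet, smul_eq_mul] at h3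
  have h4 := choose_four_lt hn
  refine lt_of_le_of_lt h1 ?_
  generalize ∑ c ∈ groundSet n, ∑ L ∈ ((groundSet n).erase c).powerset.filter (3 ≤ #·),
    #(extensions n s (starPairs c L)) = X at *
  generalize ∑ T ∈ (groundSet n).powersetCard 3, #(extensions n s (T.powersetCard 2)) = Y at *
  generalize #(extensions n s (starPairs 1 {2, 3})) = f at *
  have h5 := Nat.mul_lt_mul_of_pos_right h4 h0
  refine Nat.lt_of_mul_lt_mul_left (a := 42 * (n - 4).choose 4) ?_
  nlinarith

theorem card_interFams_eq {n s : ℕ} (hn : 21 ≤ n) {𝓑 : Finset (Finset ℕ)}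
    (h𝓑 : 𝓑 ⊆ layerEQ n 2) :
    #(interFams s (layerGE n 3 ∪ 𝓑)) = #(extensions n s ∅) +
      #𝓑 * #(extensions n s {{1, 2}}) +
      interPairs 𝓑 * #(extensions n s (starPairs 1 {2, 3})) +
      ∑ G ∈ 𝓑.powerset with 3 ≤ #G, #(extensions n s G) := by
  classical
  rw [card_interFams_eq_sum n s h𝓑]
  have key : ∀ G ∈ 𝓑.powerset, #(extensions n s G) =
      (if #G = 0 then #(extensions n s ∅) else 0) +
      (if #G = 1 then #(extensions n s {{1, 2}}) else 0) +
      (if #G = 2 ∧ ∀ A ∈ G, ∀ B ∈ G, (A ∩ B).Nonempty then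
        #(extensions n s (starPairs 1 {2, 3})) else 0) +
      (if 3 ≤ #G then #(extensions n s G) else 0) := by
    intro G hG
    have hG := (mem_powerset.1 hG).trans h𝓑
    rcases Nat.lt_or_ge #G 3 with h | h
    · interval_cases hc : #G
      · simp [card_eq_zero.1 hc]
      · simp [card_extensions_of_card_eq_one hn hG hc]
      · by_cases hI : ∀ A ∈ G, ∀ B ∈ G, (A ∩ B).Nonempty
        · rw [if_neg (by omega), if_neg (by omega), if_pos ⟨rfl, hI⟩, if_neg (by omega)]
          simp [card_extensions_of_card_eq_two hn hG hc hI]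
        · simp only [hI, and_false, if_false, card_extensions_eq_zero hI]
          simp
    · rw [if_neg (by omega), if_neg (by omega), if_neg (by omega), if_pos h]
      simp
  have c0 : #(𝓑.powerset.filter fun G => #G = 0) = 1 := by
    rw [← powersetCard_eq_filter]; simp
  have c1 : #(𝓑.powerset.filter fun G => #G = 1) = #𝓑 := by
    rw [← powersetCard_eq_filter]; simp
  have c2 : #(𝓑.powerset.filter fun G => #G = 2 ∧ ∀ A ∈ G, ∀ B ∈ G, (A ∩ B).Nonempty) =
      interPairs 𝓑 := by
    rw [← filter_filter, ← powersetCard_eq_filter]; rfl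
  rw [sum_congr rfl key, sum_add_distrib, sum_add_distrib, sum_add_distrib, ← sum_filter,
    ← sum_filter, ← sum_filter, ← sum_filter, sum_const, sum_const, sum_const, c0, c1, c2]
  simp

theorem card_layerGE (n r : ℕ) : #(layerGE n r) = ∑ k ∈ Finset.Icc r n, n.choose k := by
  have hmaps : ∀ A ∈ layerGE n r, #A ∈ Finset.Icc r n := fun A hA => by
    obtain ⟨h1, h2⟩ := mem_layerGE.1 hA
    exact Finset.mem_Icc.2 ⟨h2, (card_le_card h1).trans_eq (card_groundSet n)⟩
  rw [card_eq_sum_card_fiberwise hmaps]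
  refine sum_congr rfl fun k hk => ?_
  rw [← card_groundSet n, ← card_powersetCard, card_groundSet]
  congr 1
  ext A
  have := (Finset.mem_Icc.1 hk).1
  simp only [mem_filter, mem_layerGE, mem_powersetCard]
  grind

theorem stmt6 (n s i : ℕ) (hn : 21 ≤ n) (hs1 : 2 ≤ s) (hs2 : s ≤ 2 ^ (n - 1))
    (hi : i ≤ n.choose 2)
    (𝓑 : Finset (Finset ℕ)) (h𝓑 : 𝓑 ⊆ layerEQ n 2)
    (𝓐 : Finset (Finset ℕ)) (h𝓐 : 𝓐 = layerGE n 3 ∪ 𝓑)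
    (hcard : 𝓐.card = (∑ k ∈ Finset.Icc 3 n, n.choose k) + i)
    (hmax : ∀ 𝓑' ⊆ layerEQ n 2, (layerGE n 3 ∪ 𝓑').card = 𝓐.card →
        (interFams s (layerGE n 3 ∪ 𝓑')).card ≤ (interFams s 𝓐).card) :
    ∀ 𝓑' ⊆ layerEQ n 2, 𝓑'.card = i → interPairs 𝓑' ≤ interPairs 𝓑 := by
  intro 𝓑' h𝓑' hi'
  subst h𝓐
  have h1 := card_union_of_disjoint (disjoint_layerGE_three h𝓑)
  have h2 := card_union_of_disjoint (disjoint_layerGE_three h𝓑')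
  rw [card_layerGE] at h1 h2
  have h3 := hmax 𝓑' h𝓑' (by omega)
  rw [card_interFams_eq hn h𝓑, card_interFams_eq hn h𝓑', show #𝓑' = #𝓑 by omega] at h3
  have h4 := sum_card_extensions_three_lt hn hs1 hs2 h𝓑
  by_contra! h5
  have h6 := Nat.mul_le_mul_right #(extensions n s (starPairs 1 {2, 3})) (Nat.succ_le_of_lt h5)
  rw [Nat.succ_mul] at h6
  omega
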